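/- arXiv:2211.15232 — 4 statements merged into one kernel-verified Lean document; each statement's English description precedes it below -/
import Mathlib

section
/- Assume d = 1 and that σ has drift at least 1: ∫_G σ(g,x) dμ(g) ≥ 1 for every x ∈ X. Then Σ_{n≥1} sup_{x∈X} β{b ∈ B : S_{τ_1(b,x)}(b,x) > n} < ∞. -/
open MeasureTheory Filter Topology
open scoped ENNReal NNReal

noncomputable section

/-- The group element `b_n ⋯ b_1`, where `b_i` is coordinate `i - 1` of `b`. -/
def prodRev {G : Type*} [Monoid G] (b : ℕ → G) : ℕ → G
  | 0 => 1
  | n + 1 => b n * prodRev b n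

/-- The `n`-th convolution power of `μ`: the law of `b_n ⋯ b_1` for i.i.d. `b_i` of law `μ`. -/
def convPow {G : Type*} [Monoid G] [MeasurableSpace G] (μ : Measure G) : ℕ → Measure G
  | 0 => Measure.dirac 1
  | n + 1 => (μ.prod (convPow μ n)).map fun p => p.1 * p.2

/-- The σ-algebra on `ℕ → G` generated by the first `k` coordinates. -/
def coordSA (G : Type*) [MeasurableSpace G] (k : ℕ) : MeasurableSpace (ℕ → G) :=
  MeasurableSpace.comap (fun b (i : Fin k) => b i) MeasurableSpace.pi

/-- The exit time `τ_s(b, x) = inf {n ≥ 1 : σ(b_n ⋯ b_1, x) ≥ s}`. -/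
def exitTime {G : Type*} [Monoid G] {X : Type*} (σ : G → X → ℝ) (s : ℝ)
    (b : ℕ → G) (x : X) : ℕ :=
  sInf {n : ℕ | 1 ≤ n ∧ s ≤ σ (prodRev b n) x}

lemma prodRev_congr {G : Type*} [Monoid G] (b b' : ℕ → G) (k : ℕ)
    (h : ∀ i < k, b i = b' i) : prodRev b k = prodRev b' k := by
  induction k with
  | zero => rfl
  | succ k ih =>
    simp only [prodRev]
    rw [h k (Nat.lt_succ_self k), ih fun i hi => h i (Nat.lt_succ_of_lt hi)]

lemma measurable_prodRev {G : Type*} [Monoid G] [MeasurableSpace G] [MeasurableMul₂ G] (k : ℕ) :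
    Measurable fun b : ℕ → G => prodRev b k := by
  induction k with
  | zero => exact measurable_const
  | succ k ih => exact (measurable_pi_apply k).mul ih

lemma map_past_next {G : Type*} [MeasurableSpace G]
    (μ : Measure G) [IsProbabilityMeasure μ]
    (β : Measure (ℕ → G))
    (hβ : ∀ n : ℕ, β.map (fun b (i : Fin n) => b i) = Measure.pi fun _ : Fin n => μ) (k : ℕ) :
    β.map (fun b => (b k, fun i : Fin k => b i)) = μ.prod (Measure.pi fun _ : Fin k => μ) := by
  have h := (measurePreserving_piFinSuccAbove (fun _ : Fin (k+1) => μ) (Fin.last k)).map_eq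
  rw [← hβ (k+1), Measure.map_map (by fun_prop) (by fun_prop)] at h
  rw [← h]
  congr 1
  funext b
  simp only [Function.comp, MeasurableEquiv.piFinSuccAbove_apply, Fin.insertNthEquiv]
  ext i
  · simp
  · simp [Fin.init]

lemma lintegral_next {G : Type*} [MeasurableSpace G] [One G]
    (μ : Measure G) [IsProbabilityMeasure μ]
    (β : Measure (ℕ → G))
    (hβ : ∀ n : ℕ, β.map (fun b (i : Fin n) => b i) = Measure.pi fun _ : Fin n => μ) (k : ℕ)
    (F : (ℕ → G) → G → ℝ≥0∞) (hF : Measurable (Function.uncurry F))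
    (hdep : ∀ b b' : ℕ → G, (∀ i < k, b i = b' i) → F b = F b') :
    ∫⁻ b, F b (b k) ∂β = ∫⁻ b, ∫⁻ g, F b g ∂μ ∂β := by
  let e : (Fin k → G) → ℕ → G := fun v i => if h : i < k then v ⟨i, h⟩ else 1
  have he : Measurable e := by
    refine measurable_pi_lambda _ fun i => ?_
    by_cases h : i < k
    · simp only [e, h, dif_pos]; exact measurable_pi_apply _
    · simp only [e, h, dif_neg, not_false_eq_true]; exact measurable_const
  have hFe : ∀ b : ℕ → G, F b = F (e fun i : Fin k => b i) := fun b =>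
    hdep _ _ fun i hi => by simp [e, hi]
  have hm : Measurable fun p : G × (Fin k → G) => F (e p.2) p.1 :=
    hF.comp ((he.comp measurable_snd).prodMk measurable_fst)
  have hr : Measurable fun (b : ℕ → G) (i : Fin k) => b i := by fun_prop
  calc ∫⁻ b, F b (b k) ∂β
      = ∫⁻ b, (fun p : G × (Fin k → G) => F (e p.2) p.1) (b k, fun i : Fin k => b i) ∂β := by
        refine lintegral_congr fun b => ?_
        rw [hFe b]
    _ = ∫⁻ p, F (e p.2) p.1 ∂(μ.prod (Measure.pi fun _ : Fin k => μ)) := by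
        rw [← map_past_next μ β hβ k, lintegral_map hm (by fun_prop)]
    _ = ∫⁻ v, ∫⁻ g, F (e v) g ∂μ ∂(Measure.pi fun _ : Fin k => μ) := by
        rw [lintegral_prod_symm _ hm.aemeasurable]
    _ = ∫⁻ b, ∫⁻ g, F b g ∂μ ∂β := by
        rw [← hβ k, lintegral_map (Measurable.lintegral_prod_left' hm) hr]
        refine lintegral_congr fun b => ?_
        rw [hFe b]

lemma exists_trunc {G : Type*} [MeasurableSpace G] (μ : Measure G)
    (N : G → ℝ) (hN0 : ∀ g, 0 ≤ N g) (hmom1 : Integrable N μ) :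
    ∃ M : ℝ, 0 ≤ M ∧ ∫ g, max (N g - M) 0 ∂μ ≤ 1 / 2 := by
  have h : Tendsto (fun n : ℕ => ∫ g, max (N g - n) 0 ∂μ) atTop (𝓝 (∫ _, (0 : ℝ) ∂μ)) := by
    refine tendsto_integral_of_dominated_convergence N (fun n => ?_) hmom1 (fun n => ?_) ?_
    · exact (hmom1.1.sub aestronglyMeasurable_const).sup aestronglyMeasurable_const
    · refine ae_of_all _ fun g => ?_
      rw [Real.norm_eq_abs, abs_of_nonneg (le_max_right _ _)]
      exact max_le (by have : (0 : ℝ) ≤ n := n.cast_nonneg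
                       linarith) (hN0 g)
    · refine ae_of_all _ fun g => ?_
      refine tendsto_const_nhds.congr' ?_
      obtain ⟨m, hm⟩ := exists_nat_ge (N g)
      filter_upwards [eventually_ge_atTop m] with n hn
      have : (m : ℝ) ≤ n := by exact_mod_cast hn
      rw [max_eq_right]; linarith
  simp only [integral_zero] at h
  obtain ⟨n, hn⟩ := (h.eventually (gt_mem_nhds (show (0 : ℝ) < 1 / 2 by norm_num))).exists
  exact ⟨n, n.cast_nonneg, hn.le⟩

/-- One step of the potential-function inequality. -/
lemma one_step {G : Type*} [MeasurableSpace G] (μ : Measure G) [IsProbabilityMeasure μ]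
    (N f : G → ℝ) (hmom1 : Integrable N μ) (hf : Measurable f) (hfN : ∀ g, |f g| ≤ N g)
    (hd : 1 ≤ ∫ g, f g ∂μ) (M : ℝ) (hM0 : 0 ≤ M)
    (hM : ∫ g, max (N g - M) 0 ∂μ ≤ 1 / 2) (s : ℝ) (hs : s < 1) :
    ∫⁻ g, (if s + f g < 1 then ENNReal.ofReal (2 * (1 + M - (s + f g))) else 0) ∂μ + 1
      ≤ ENNReal.ofReal (2 * (1 + M - s)) := by
  have hfi : Integrable f μ := hmom1.mono' hf.aestronglyMeasurable (ae_of_all _ hfN)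
  have hmi : Integrable (fun g => max (N g - M) 0) μ :=
    (hmom1.sub (integrable_const M)).sup (integrable_const 0)
  let q : G → ℝ := fun g => 2 * (1 + M - s - f g + max (N g - M) 0)
  have hqi : Integrable q μ :=
    ((((integrable_const _).sub hfi).add hmi).const_mul 2)
  have hf' : ∀ g, f g ≤ N g := fun g => (le_abs_self _).trans (hfN g)
  have hq0 : ∀ g, 0 ≤ q g := fun g => by
    have h1 := le_max_left (N g - M) 0
    have := hf' g
    simp only [q]; linarith
  have hqint : ∫ g, q g ∂μ ≤ 2 * (1 + M - s) - 1 := by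
    have : ∫ g, q g ∂μ = 2 * (1 + M - s - ∫ g, f g ∂μ + ∫ g, max (N g - M) 0 ∂μ) := by
      simp only [q]
      rw [integral_const_mul, integral_add (f := fun g => 1 + M - s - f g) ((integrable_const _).sub hfi) hmi,
        integral_sub (integrable_const _) hfi]
      simp
    rw [this]; linarith
  have h1 : ∫⁻ g, (if s + f g < 1 then ENNReal.ofReal (2 * (1 + M - (s + f g))) else 0) ∂μ
      ≤ ∫⁻ g, ENNReal.ofReal (q g) ∂μ := by
    refine lintegral_mono fun g => ?_
    dsimp only
    split_ifs with h
    · apply ENNReal.ofReal_le_ofReal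
      have h1 := le_max_right (N g - M) 0
      simp only [q]; linarith
    · exact zero_le
  rw [← ofReal_integral_eq_lintegral_ofReal hqi (ae_of_all _ hq0)] at h1
  calc _ ≤ ENNReal.ofReal (∫ g, q g ∂μ) + ENNReal.ofReal 1 := by
        rw [ENNReal.ofReal_one]; gcongr
    _ = ENNReal.ofReal (∫ g, q g ∂μ + 1) :=
        (ENNReal.ofReal_add (integral_nonneg hq0) zero_le_one).symm
    _ ≤ _ := ENNReal.ofReal_le_ofReal (by linarith)

/-- The event that the walk stays below `1` up to time `k`. -/
def belowSet {G : Type*} [Monoid G] {X : Type*} (σ : G → X → ℝ) (x : X) (k : ℕ) :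
    Set (ℕ → G) :=
  {b | ∀ j ≤ k, σ (prodRev b j) x < 1}

lemma measurableSet_belowSet {G : Type*} [Monoid G] [MeasurableSpace G] [MeasurableMul₂ G]
    {X : Type*} (σ : G → X → ℝ) (x : X) (hσ : Measurable fun g => σ g x) (k : ℕ) :
    MeasurableSet (belowSet σ x k) := by
  have : belowSet σ x k = ⋂ j, ⋂ (_ : j ≤ k), {b | σ (prodRev b j) x < 1} := by
    ext b; simp [belowSet]
  rw [this]
  exact MeasurableSet.iInter fun j => MeasurableSet.iInter fun _ =>
    measurableSet_lt (hσ.comp (measurable_prodRev j)) measurable_const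

lemma belowSet_congr {G : Type*} [Monoid G] {X : Type*} (σ : G → X → ℝ) (x : X) (k : ℕ)
    (b b' : ℕ → G) (h : ∀ i < k, b i = b' i) : b ∈ belowSet σ x k ↔ b' ∈ belowSet σ x k := by
  have : ∀ j ≤ k, prodRev b j = prodRev b' j := fun j hj =>
    prodRev_congr b b' j fun i hi => h i (by omega)
  constructor <;> intro hb j hj
  · rw [← this j hj]; exact hb j hj
  · rw [this j hj]; exact hb j hj

/-- summability of the tails of the overshoot at time tau_1. -/
theorem overshoot_tail_summable
    {G : Type*} [Group G] [MeasurableSpace G] [MeasurableMul₂ G]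
    {X : Type*} [MetricSpace X] [CompactSpace X] [MeasurableSpace X] [BorelSpace X]
    [MulAction G X] (hact : Measurable fun p : G × X => p.1 • p.2)
    (σ : G → X → ℝ)
    (hσmeas : Measurable fun p : G × X => σ p.1 p.2)
    (hcoc : ∀ g₁ g₂ : G, ∀ x : X, σ (g₂ * g₁) x = σ g₂ (g₁ • x) + σ g₁ x)
    (N : G → ℝ) (hN0 : ∀ g, 0 ≤ N g) (hNsub : ∀ g h : G, N (g * h) ≤ N g + N h)
    (hNσ : ∀ g x, |σ g x| ≤ N g)
    (μ : Measure G) [IsProbabilityMeasure μ]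
    (hmom1 : Integrable N μ)
    (hdrift : ∀ x, (1 : ℝ) ≤ ∫ g, σ g x ∂μ)
    (β : Measure (ℕ → G)) [IsProbabilityMeasure β]
    (hβ : ∀ n : ℕ, β.map (fun b (i : Fin n) => b i) = Measure.pi fun _ : Fin n => μ) :
    ∑' n : ℕ, ⨆ x : X,
      β {b | (n : ℝ) + 1 < σ (prodRev b (exitTime σ 1 b x)) x} < ⊤ := by
  classical
  obtain ⟨M, hM0, hM⟩ := exists_trunc μ N hN0 hmom1
  have hσ1 : ∀ x, σ 1 x = 0 := fun x => by
    have := hcoc 1 1 x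
    simp at this; exact this
  have hσx : ∀ x, Measurable fun g => σ g x := fun x =>
    hσmeas.comp (measurable_id.prodMk measurable_const)
  have hstep : ∀ (b : ℕ → G) k x, σ (prodRev b (k+1)) x
      = σ (prodRev b k) x + σ (b k) (prodRev b k • x) := fun b k x => by
    simp only [prodRev]; rw [hcoc]; ring
  have hpt : ∀ (x : X) (k : ℕ), Measurable fun p : (ℕ → G) × G => σ p.2 (prodRev p.1 k • x) := by
    intro x k
    have h1 : Measurable fun p : (ℕ → G) × G => prodRev p.1 k • x :=
      hact.comp (((measurable_prodRev k).comp measurable_fst).prodMk measurable_const)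
    exact hσmeas.comp (measurable_snd.prodMk h1)
  have hSm : ∀ (x : X) (k : ℕ), Measurable fun b : ℕ → G => σ (prodRev b k) x := fun x k =>
    (hσx x).comp (measurable_prodRev k)
  let H : ℝ → ℝ≥0∞ := fun s => if s < 1 then ENNReal.ofReal (2 * (1 + M - s)) else 0
  have hH : Measurable H :=
    Measurable.ite measurableSet_Iio (by fun_prop) measurable_const
  have hA := fun x k => measurableSet_belowSet σ x (hσx x) k
  -- expected potential
  let E : X → ℕ → ℝ≥0∞ := fun x k =>
    ∫⁻ b, (belowSet σ x k).indicator (fun b => H (σ (prodRev b k) x)) b ∂β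
  have hrec : ∀ x k, E x (k+1) + β (belowSet σ x k) ≤ E x k := by
    intro x k
    let F : (ℕ → G) → G → ℝ≥0∞ := fun b g =>
      (belowSet σ x k).indicator
        (fun b => H (σ (prodRev b k) x + σ g (prodRev b k • x))) b
    have hFm : Measurable (Function.uncurry F) := by
      have : Function.uncurry F = (Prod.fst ⁻¹' belowSet σ x k).indicator
          (fun p : (ℕ → G) × G => H (σ (prodRev p.1 k) x + σ p.2 (prodRev p.1 k • x))) := by
        funext p; rfl
      rw [this]
      exact (hH.comp (((hSm x k).comp measurable_fst).add (hpt x k))).indicator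
        (measurable_fst (hA x k))
    have h1 : E x (k+1) ≤ ∫⁻ b, F b (b k) ∂β := by
      refine lintegral_mono fun b => ?_
      simp only [F, Set.indicator]
      split_ifs with h1 h2
      · rw [hstep]
      · exact absurd (fun j hj => h1 j (Nat.le_succ_of_le hj)) h2
      · exact zero_le
      · exact zero_le
    rw [lintegral_next μ β hβ k F hFm ?_] at h1
    · have h2 : β (belowSet σ x k) = ∫⁻ b, (belowSet σ x k).indicator 1 b ∂β := by
        rw [lintegral_indicator_one (hA x k)]
      calc _ ≤ (∫⁻ b, ∫⁻ g, F b g ∂μ ∂β) + ∫⁻ b, (belowSet σ x k).indicator 1 b ∂β := by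
            rw [h2]; gcongr
        _ = ∫⁻ b, (∫⁻ g, F b g ∂μ + (belowSet σ x k).indicator 1 b) ∂β := by
            rw [lintegral_add_right _ (measurable_one.indicator (hA x k))]
        _ ≤ E x k := by
            refine lintegral_mono fun b => ?_
            by_cases hb : b ∈ belowSet σ x k
            · simp only [F, Set.indicator_of_mem hb, Pi.one_apply, H]
              rw [if_pos (hb k le_rfl)]
              exact one_step μ N (fun g => σ g (prodRev b k • x)) hmom1 (hσx _)
                (fun g => hNσ g _) (hdrift _) M hM0 hM _ (hb k le_rfl)
            · simp [F, Set.indicator_of_notMem hb]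
    · intro b b' hbb
      funext g
      have hi := belowSet_congr σ x k b b' hbb
      simp only [F, Set.indicator, hi, prodRev_congr b b' k hbb]
  have hE0 : ∀ x, E x 0 ≤ ENNReal.ofReal (2 * (1 + M)) := by
    intro x
    calc E x 0 ≤ ∫⁻ _, ENNReal.ofReal (2 * (1 + M)) ∂β := by
          refine lintegral_mono fun b => ?_
          refine (Set.indicator_le_self _ _ b).trans ?_
          simp [prodRev, hσ1, H]
      _ = _ := by simp
  have hsum : ∀ x, ∑' k, β (belowSet σ x k) ≤ ENNReal.ofReal (2 * (1 + M)) := by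
    intro x
    refine ENNReal.tsum_le_of_sum_range_le fun K => ?_
    have : ∀ K, E x K + ∑ k ∈ Finset.range K, β (belowSet σ x k) ≤ E x 0 := by
      intro K
      induction K with
      | zero => simp
      | succ K ih =>
        rw [Finset.sum_range_succ]
        calc _ = (E x (K+1) + β (belowSet σ x K)) + ∑ k ∈ Finset.range K, β (belowSet σ x k) := by
              ring
          _ ≤ E x K + ∑ k ∈ Finset.range K, β (belowSet σ x k) := by
              gcongr; exact hrec x K
          _ ≤ _ := ih
    exact (le_add_self.trans (this K)).trans (hE0 x)
  have hmain : ∀ (n : ℕ) x, β {b | (n : ℝ) + 1 < σ (prodRev b (exitTime σ 1 b x)) x}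
      ≤ ENNReal.ofReal (2 * (1 + M)) * μ {g | N g ∈ Set.Ioi (n : ℝ)} := by
    intro n x
    let D : ℕ → Set (ℕ → G) := fun k =>
      {b | b ∈ belowSet σ x k ∧ (n : ℝ) < σ (b k) (prodRev b k • x)}
    have hsub : {b | (n : ℝ) + 1 < σ (prodRev b (exitTime σ 1 b x)) x} ⊆ ⋃ k, D k := by
      intro b hb
      simp only [Set.mem_setOf_eq] at hb
      have hn0 : (0 : ℝ) ≤ n := n.cast_nonneg
      rcases Nat.eq_zero_or_pos (exitTime σ 1 b x) with h0 | h0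
      · rw [h0] at hb
        simp only [prodRev, hσ1] at hb
        linarith
      obtain ⟨k, hk⟩ : ∃ k, exitTime σ 1 b x = k + 1 := ⟨_, (Nat.succ_pred_eq_of_pos h0).symm⟩
      have hbel : b ∈ belowSet σ x k := by
        intro j hj
        rcases Nat.eq_zero_or_pos j with rfl | hj0
        · simp [prodRev, hσ1]
        · by_contra hc
          have : exitTime σ 1 b x ≤ j := Nat.sInf_le ⟨hj0, not_lt.1 hc⟩
          omega
      refine Set.mem_iUnion.2 ⟨k, hbel, ?_⟩
      rw [hk, hstep] at hb
      have := hbel k le_rfl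
      linarith
    have hD : ∀ k, β (D k) ≤ β (belowSet σ x k) * μ {g | N g ∈ Set.Ioi (n : ℝ)} := by
      intro k
      let F : (ℕ → G) → G → ℝ≥0∞ := fun b g =>
        (belowSet σ x k).indicator
          (fun b => {g | (n : ℝ) < σ g (prodRev b k • x)}.indicator 1 g) b
      have hFm : Measurable (Function.uncurry F) := by
        have : Function.uncurry F = (Prod.fst ⁻¹' belowSet σ x k).indicator
            ({p : (ℕ → G) × G | (n : ℝ) < σ p.2 (prodRev p.1 k • x)}.indicator 1) := by
          funext p; rfl
        rw [this]
        exact (measurable_one.indicator (measurableSet_lt measurable_const (hpt x k))).indicator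
          (measurable_fst (hA x k))
      have hDm : MeasurableSet (D k) := (hA x k).inter
        (measurableSet_lt measurable_const
          ((hpt x k).comp (measurable_id.prodMk (measurable_pi_apply k))))
      calc β (D k) = ∫⁻ b, F b (b k) ∂β := by
            rw [← lintegral_indicator_one hDm]
            refine lintegral_congr fun b => ?_
            by_cases h1 : b ∈ belowSet σ x k <;>
              by_cases h2 : (n : ℝ) < σ (b k) (prodRev b k • x) <;>
              simp [F, D, Set.indicator, h1, h2]
        _ = ∫⁻ b, ∫⁻ g, F b g ∂μ ∂β := by
            refine lintegral_next μ β hβ k F hFm ?_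
            intro b b' hbb
            funext g
            have hi := belowSet_congr σ x k b b' hbb
            simp only [F, Set.indicator, hi, prodRev_congr b b' k hbb]
        _ ≤ ∫⁻ b, (belowSet σ x k).indicator
              (fun _ => μ {g | N g ∈ Set.Ioi (n : ℝ)}) b ∂β := by
            refine lintegral_mono fun b => ?_
            by_cases hb : b ∈ belowSet σ x k
            · simp only [F, Set.indicator_of_mem hb]
              rw [lintegral_indicator_one (measurableSet_lt measurable_const (hσx _))]
              refine measure_mono fun g hg => ?_
              exact lt_of_lt_of_le hg ((le_abs_self _).trans (hNσ g _))
            · simp [F, Set.indicator_of_notMem hb]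
        _ = _ := by
            rw [lintegral_indicator_const (hA x k), mul_comm]
    calc _ ≤ β (⋃ k, D k) := measure_mono hsub
      _ ≤ ∑' k, β (D k) := measure_iUnion_le _
      _ ≤ ∑' k, β (belowSet σ x k) * μ {g | N g ∈ Set.Ioi (n : ℝ)} := ENNReal.tsum_le_tsum hD
      _ = (∑' k, β (belowSet σ x k)) * μ {g | N g ∈ Set.Ioi (n : ℝ)} := ENNReal.tsum_mul_right
      _ ≤ _ := by gcongr; exact hsum x
  have hfin : ∑' n : ℕ, μ {g | N g ∈ Set.Ioi (n : ℝ)} < ⊤ := by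
    letI : MeasureSpace G := ⟨μ⟩
    haveI : IsProbabilityMeasure (volume : Measure G) := ‹IsProbabilityMeasure μ›
    exact ProbabilityTheory.tsum_prob_mem_Ioi_lt_top hmom1 hN0
  calc _ ≤ ∑' n : ℕ, ENNReal.ofReal (2 * (1 + M)) * μ {g | N g ∈ Set.Ioi (n : ℝ)} :=
        ENNReal.tsum_le_tsum fun n => iSup_le fun x => hmain n x
    _ = ENNReal.ofReal (2 * (1 + M)) * ∑' n : ℕ, μ {g | N g ∈ Set.Ioi (n : ℝ)} :=
        ENNReal.tsum_mul_left
    _ < ⊤ := ENNReal.mul_lt_top ENNReal.ofReal_lt_top hfin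
end
end

section
/- Assume d = 1, μ has finite exponential moment, σ is X-controlled, and the limit variance A > 0, where A is the number such that (1/n) ∫_G σ(g,x)² dμ^{*n}(g) → A uniformly in x. Fix k, l > 0 and families (k_s)_{s>0}, (l_s)_{s>0} of reals with k_s ∼ sk and l_s ∼ sl as s → ∞. Fix x ∈ X and put M_n(b) = σ(b_n⋯b_1, x). Then β{b ∈ B : there exists n ≤ s³ with M_n(b) ∉ [−k_s, l_s]} → 1 as s → ∞. -/
open MeasureTheory Filter Topology
open scoped ENNReal NNReal

noncomputable section

section ExitWindowHelpers

variable {G : Type*} [Group G] [MeasurableSpace G] [MeasurableMul₂ G]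

lemma ew_meas_prodRev (n : ℕ) : Measurable fun b : ℕ → G => prodRev b n := by
  induction n with
  | zero => exact measurable_const
  | succ n ih => exact (measurable_pi_apply n).mul ih

lemma ew_meas_prodRev_shift (n m : ℕ) :
    Measurable fun b : ℕ → G => prodRev (fun i => b (n + i)) m := by
  induction m with
  | zero => exact measurable_const
  | succ m ih => exact (measurable_pi_apply (n + m)).mul ih

lemma ew_prodRev_congr (n : ℕ) (b b' : ℕ → G) (h : ∀ i < n, b i = b' i) :
    prodRev b n = prodRev b' n := by
  induction n with
  | zero => rfl
  | succ n ih =>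
    simp only [prodRev]
    rw [ih fun i hi => h i (by omega), h n (by omega)]

lemma ew_prodRev_add (b : ℕ → G) (n m : ℕ) :
    prodRev b (n + m) = prodRev (fun i => b (n + i)) m * prodRev b n := by
  induction m with
  | zero => simp [prodRev]
  | succ m ih =>
    rw [← add_assoc]
    simp only [prodRev]
    rw [ih, mul_assoc]

instance ew_convPow_prob (μ : Measure G) [IsProbabilityMeasure μ] (n : ℕ) :
    IsProbabilityMeasure (convPow μ n) := by
  induction n with
  | zero => exact Measure.dirac.isProbabilityMeasure
  | succ n ih =>
    exact Measure.isProbabilityMeasure_map (by fun_prop)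

lemma ew_one_step (μ : Measure G) [IsProbabilityMeasure μ]
    (β : Measure (ℕ → G)) [IsProbabilityMeasure β]
    (hβ : ∀ n : ℕ, β.map (fun b (i : Fin n) => b i) = Measure.pi fun _ : Fin n => μ)
    (n : ℕ) (Φ : (ℕ → G) → G → ℝ≥0∞) (hΦ : Measurable fun p : (ℕ → G) × G => Φ p.1 p.2)
    (hdep : ∀ b b' : ℕ → G, (∀ i < n, b i = b' i) → ∀ g, Φ b g = Φ b' g) :
    ∫⁻ b, Φ b (b n) ∂β = ∫⁻ b, ∫⁻ g, Φ b g ∂μ ∂β := by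
  let ext : (Fin n → G) → ℕ → G := fun v i => if h : i < n then v ⟨i, h⟩ else 1
  have hext : Measurable ext := by
    refine measurable_pi_lambda _ fun i => ?_
    by_cases h : i < n
    · simp only [ext, h, dite_true]; exact measurable_pi_apply _
    · simp only [ext, h, dite_false]; exact measurable_const
  have hres : ∀ k : ℕ, Measurable (fun (b : ℕ → G) (i : Fin k) => b i) := fun k =>
    measurable_pi_lambda _ fun i => measurable_pi_apply _
  have key : ∀ b : ℕ → G, ∀ g, Φ b g = Φ (ext fun i : Fin n => b i) g := by
    intro b g
    refine hdep _ _ (fun i hi => ?_) g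
    simp [ext, hi]
  have hW : Measurable fun p : G × (Fin n → G) => Φ (ext p.2) p.1 :=
    hΦ.comp ((hext.comp measurable_snd).prodMk measurable_fst)
  have hmp := measurePreserving_piFinSuccAbove (fun _ : Fin (n+1) => μ) (Fin.last n)
  have hlaw : β.map (fun b => (b n, fun i : Fin n => b i))
      = μ.prod (Measure.pi fun _ : Fin n => μ) := by
    have h1 := hmp.map_eq
    rw [← hβ (n+1), Measure.map_map hmp.measurable (hres _)] at h1
    rw [← h1]
    congr 1
    funext b
    simp only [Function.comp, MeasurableEquiv.piFinSuccAbove, Fin.insertNthEquiv]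
    ext i
    · simp
    · simp [Fin.init]
  have hm : Measurable (fun b : ℕ → G => (b n, fun i : Fin n => b i)) :=
    (measurable_pi_apply n).prodMk (hres n)
  calc ∫⁻ b, Φ b (b n) ∂β = ∫⁻ b, Φ (ext fun i : Fin n => b i) (b n) ∂β := by
        refine lintegral_congr fun b => key b _
    _ = ∫⁻ p, Φ (ext p.2) p.1 ∂(β.map (fun b => (b n, fun i : Fin n => b i))) := by
        rw [lintegral_map hW hm]
    _ = ∫⁻ v, ∫⁻ g, Φ (ext v) g ∂μ ∂(Measure.pi fun _ : Fin n => μ) := by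
        rw [hlaw, lintegral_prod_symm' _ hW]
    _ = ∫⁻ b, ∫⁻ g, Φ (ext fun i : Fin n => b i) g ∂μ ∂β := by
        rw [← hβ n, lintegral_map _ (hres n)]
        exact hW.lintegral_prod_left'
    _ = _ := by
        refine lintegral_congr fun b => lintegral_congr fun g => (key b g).symm

lemma ew_block_step (μ : Measure G) [IsProbabilityMeasure μ]
    (β : Measure (ℕ → G)) [IsProbabilityMeasure β]
    (hβ : ∀ n : ℕ, β.map (fun b (i : Fin n) => b i) = Measure.pi fun _ : Fin n => μ)
    (n m : ℕ) : ∀ (Φ : (ℕ → G) → G → ℝ≥0∞)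
    (_ : Measurable fun p : (ℕ → G) × G => Φ p.1 p.2)
    (_ : ∀ b b' : ℕ → G, (∀ i < n, b i = b' i) → ∀ g, Φ b g = Φ b' g),
    ∫⁻ b, Φ b (prodRev (fun i => b (n + i)) m) ∂β = ∫⁻ b, ∫⁻ g, Φ b g ∂(convPow μ m) ∂β := by
  induction m with
  | zero =>
    intro Φ hΦ hdep
    refine lintegral_congr fun b => ?_
    simp only [prodRev, convPow]
    have hb : Measurable (Φ b) := hΦ.comp (measurable_const.prodMk measurable_id)
    rw [lintegral_dirac' _ hb]
  | succ m ih =>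
    intro Φ hΦ hdep
    have h1 := ew_one_step μ β hβ (n + m)
      (fun b g => Φ b (g * prodRev (fun i => b (n + i)) m))
      (hΦ.comp (measurable_fst.prodMk (measurable_snd.mul
        ((ew_meas_prodRev_shift n m).comp measurable_fst))))
      (by
        intro b b' h g
        rw [hdep b b' (fun i hi => h i (by omega)),
          ew_prodRev_congr m (fun i => b (n+i)) (fun i => b' (n+i))
            (fun i hi => h _ (by omega))])
    have hΨ : Measurable fun q : ((ℕ → G) × G) × G => Φ q.1.1 (q.2 * q.1.2) :=
      hΦ.comp ((measurable_fst.comp measurable_fst).prodMk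
        (measurable_snd.mul (measurable_snd.comp measurable_fst)))
    have h2 := ih (fun b h => ∫⁻ g, Φ b (g * h) ∂μ) hΨ.lintegral_prod_right'
      (by
        intro b b' h g
        refine lintegral_congr fun g' => hdep b b' h _)
    simp only [prodRev]
    rw [h1, h2]
    refine lintegral_congr fun b => ?_
    have hb : Measurable (Φ b) := hΦ.comp (measurable_const.prodMk measurable_id)
    simp only [convPow]
    rw [lintegral_map hb (by fun_prop), lintegral_prod_symm']
    exact hb.comp (by fun_prop)

variable {X : Type*} [MetricSpace X] [CompactSpace X] [MeasurableSpace X] [BorelSpace X]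
    [MulAction G X]

lemma ew_pow_four (u v : ℝ) : (u + v)^4 ≤ 8 * (u^4 + v^4) := by
  have h1 : (u + v)^2 ≤ 2 * (u^2 + v^2) := by nlinarith [sq_nonneg (u - v)]
  have h2 : ((u + v)^2)^2 ≤ (2 * (u^2 + v^2))^2 := pow_le_pow_left₀ (sq_nonneg _) h1 2
  have h3 : (2 * (u^2 + v^2))^2 ≤ 8 * (u^4 + v^4) := by nlinarith [sq_nonneg (u^2 - v^2)]
  calc (u + v)^4 = ((u + v)^2)^2 := by ring
    _ ≤ _ := h2.trans h3

lemma ew_fourth (hact : Measurable fun p : G × X => p.1 • p.2)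
    (σ : G → X → ℝ) (hσmeas : Measurable fun p : G × X => σ p.1 p.2)
    (hcoc : ∀ g₁ g₂ : G, ∀ x : X, σ (g₂ * g₁) x = σ g₂ (g₁ • x) + σ g₁ x)
    (μ : Measure G) [IsProbabilityMeasure μ] (K : ℝ≥0∞) (hK : K ≠ ∞)
    (h4 : ∀ x, ∫⁻ g, ENNReal.ofReal (σ g x ^ 4) ∂μ ≤ K) (m : ℕ) :
    ∃ K' : ℝ≥0∞, K' ≠ ∞ ∧ ∀ x, ∫⁻ g, ENNReal.ofReal (σ g x ^ 4) ∂(convPow μ m) ≤ K' := by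
  have hms : ∀ x, Measurable fun g => σ g x := fun x =>
    hσmeas.comp (measurable_id.prodMk measurable_const)
  have hma : ∀ x : X, Measurable fun g : G => g • x := fun x =>
    hact.comp (measurable_id.prodMk measurable_const)
  induction m with
  | zero =>
    refine ⟨0, by simp, fun x => ?_⟩
    have h1 : σ 1 x = 0 := by have := hcoc 1 1 x; simp at this; exact this
    simp only [convPow]
    rw [lintegral_dirac' _ (((hms x).pow_const 4).ennreal_ofReal)]
    simp [h1]
  | succ m ih =>
    obtain ⟨K', hK', h⟩ := ih
    refine ⟨8 * (K + K'), by finiteness, fun x => ?_⟩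
    have e1 : Measurable fun p : G × G => ENNReal.ofReal (σ p.1 (p.2 • x) ^ 4) :=
      ((hσmeas.comp (measurable_fst.prodMk ((hma x).comp measurable_snd))).pow_const 4).ennreal_ofReal
    have e2 : Measurable fun p : G × G => ENNReal.ofReal (σ p.2 x ^ 4) :=
      (((hms x).comp measurable_snd).pow_const 4).ennreal_ofReal
    simp only [convPow]
    rw [lintegral_map (((hms x).pow_const 4).ennreal_ofReal) (by fun_prop)]
    calc _ ≤ ∫⁻ p : G × G, 8 * (ENNReal.ofReal (σ p.1 (p.2 • x) ^ 4)
              + ENNReal.ofReal (σ p.2 x ^ 4)) ∂(μ.prod (convPow μ m)) := by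
            refine lintegral_mono fun p => ?_
            have : (8 : ℝ≥0∞) = ENNReal.ofReal 8 := by simp
            rw [hcoc, this, ← ENNReal.ofReal_add (by positivity) (by positivity),
              ← ENNReal.ofReal_mul (by norm_num)]
            apply ENNReal.ofReal_le_ofReal
            exact ew_pow_four _ _
      _ = 8 * ((∫⁻ p : G × G, ENNReal.ofReal (σ p.1 (p.2 • x) ^ 4) ∂(μ.prod (convPow μ m)))
            + ∫⁻ p : G × G, ENNReal.ofReal (σ p.2 x ^ 4) ∂(μ.prod (convPow μ m))) := by
            rw [lintegral_const_mul' _ _ (by norm_num), lintegral_add_left e1]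
      _ ≤ 8 * (K + K') := by
            refine mul_le_mul_right (add_le_add ?_ ?_) _
            · rw [lintegral_prod_symm' _ e1]
              refine (lintegral_mono (g := fun _ => K) fun y => h4 (y • x)).trans ?_
              simp
            · rw [lintegral_prod_symm' _ e2]
              simp only [lintegral_const, measure_univ, mul_one]
              exact h x

lemma ew_integrable4 (ν : Measure G) [IsProbabilityMeasure ν] (f : G → ℝ) (hf : Measurable f)
    (h : ∫⁻ g, ENNReal.ofReal (f g ^ 4) ∂ν ≠ ∞) :
    Integrable (fun g => f g ^ 4) ν ∧ Integrable (fun g => f g ^ 2) ν ∧ Integrable f ν := by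
  have h4 : Integrable (fun g => f g ^ 4) ν := by
    refine ⟨(hf.pow_const 4).aestronglyMeasurable, ?_⟩
    rw [hasFiniteIntegral_iff_ofReal (Eventually.of_forall fun g => by positivity)]
    exact lt_top_iff_ne_top.2 h
  refine ⟨h4, ?_, ?_⟩
  · refine ((integrable_const (1:ℝ)).add h4).mono' (hf.pow_const 2).aestronglyMeasurable
      (Eventually.of_forall fun g => ?_)
    simp only [Real.norm_eq_abs, Pi.add_apply, abs_of_nonneg (sq_nonneg (f g))]
    nlinarith [sq_nonneg (f g ^ 2 - 1), sq_nonneg (f g)]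
  · refine ((integrable_const (1:ℝ)).add h4).mono' hf.aestronglyMeasurable
      (Eventually.of_forall fun g => ?_)
    simp only [Real.norm_eq_abs, Pi.add_apply]
    rw [abs_le]
    constructor <;> nlinarith [sq_nonneg (f g ^ 2 - 1), sq_nonneg (f g - 1), sq_nonneg (f g + 1), sq_nonneg (f g ^2)]

lemma ew_mean (hact : Measurable fun p : G × X => p.1 • p.2)
    (σ : G → X → ℝ) (hσmeas : Measurable fun p : G × X => σ p.1 p.2)
    (hcoc : ∀ g₁ g₂ : G, ∀ x : X, σ (g₂ * g₁) x = σ g₂ (g₁ • x) + σ g₁ x)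
    (μ : Measure G) [IsProbabilityMeasure μ]
    (hint : ∀ m x, Integrable (fun g => σ g x) (convPow μ m))
    (hint1 : ∀ x, Integrable (fun g => σ g x) μ)
    (hdrift : ∀ x, ∫ g, σ g x ∂μ = 0) (m : ℕ) (x : X) :
    ∫ g, σ g x ∂(convPow μ m) = 0 := by
  have hms : ∀ x, Measurable fun g => σ g x := fun x =>
    hσmeas.comp (measurable_id.prodMk measurable_const)
  induction m with
  | zero =>
    have h1 : σ 1 x = 0 := by have := hcoc 1 1 x; simp at this; exact this
    simp only [convPow]
    rw [integral_dirac' _ _ (hms x).stronglyMeasurable, h1]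
  | succ m ih =>
    have hi := hint (m+1) x
    simp only [convPow] at hi ⊢
    have hi' : Integrable (fun p : G × G => σ (p.1 * p.2) x) (μ.prod (convPow μ m)) := (integrable_map_measure (hms x).aestronglyMeasurable (by fun_prop)).1 hi
    rw [integral_map (by fun_prop) (hms x).aestronglyMeasurable]
    rw [integral_prod_symm _ hi']
    simp only [hcoc]
    have : ∀ y : G, ∫ g, σ g (y • x) + σ y x ∂μ = σ y x := by
      intro y
      rw [integral_add (hint1 _) (integrable_const _), hdrift]
      simp
    simp only [this, ih]

lemma ew_real_ineq (L t u : ℝ) (hL : 0 < L) (ht : |t| ≤ L) :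
    max (4 * L^2 - (t + u)^2) 0 ≤ 4 * L^2 - t^2 - 2 * t * u - u^2 + 4 / L^2 * u^4 := by
  have hL2 : 0 < L^2 := by positivity
  have h0 : 0 ≤ 4 / L^2 * u^4 := by positivity
  rcases le_total 0 (4 * L^2 - (t + u)^2) with h | h
  · rw [max_eq_left h]; nlinarith
  · rw [max_eq_right h]
    have h1 : 2 * L ≤ |t + u| := by
      apply le_of_sq_le_sq _ (abs_nonneg _)
      rw [sq_abs]; nlinarith
    have h2 := abs_add_le t u
    have h3 : L ≤ |u| := by linarith
    have h4 : |t + u| ≤ 2 * |u| := by linarith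
    have h5 : (t + u)^2 ≤ 4 * u^2 := by
      rw [← sq_abs (t+u), ← sq_abs u]; nlinarith [abs_nonneg (t+u)]
    have h6 : L^2 ≤ u^2 := by rw [← sq_abs u]; nlinarith
    have h7 : 4 * u^2 ≤ 4 / L^2 * u^4 := by
      rw [div_mul_eq_mul_div, le_div_iff₀ hL2]
      nlinarith [sq_nonneg u]
    nlinarith

lemma ew_lyap (ν : Measure G) [IsProbabilityMeasure ν] (f : G → ℝ) (hf : Measurable f)
    (K c L t : ℝ) (hL : 0 < L) (ht : |t| ≤ L) (hc : 0 < c)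
    (i4 : Integrable (fun g => f g ^ 4) ν) (i2 : Integrable (fun g => f g ^ 2) ν)
    (i1 : Integrable f ν) (m0 : ∫ g, f g ∂ν = 0) (m2 : 2 * c ≤ ∫ g, f g ^ 2 ∂ν)
    (m4 : ∫ g, f g ^ 4 ∂ν ≤ K) (hKL : 4 * K ≤ c * L^2) :
    ENNReal.ofReal c + ∫⁻ g, ENNReal.ofReal (max (4 * L^2 - (t + f g)^2) 0) ∂ν
      ≤ ENNReal.ofReal (max (4 * L^2 - t^2) 0) := by
  have hL2 : 0 < L^2 := by positivity
  have ht2 : t^2 ≤ L^2 := by rw [← sq_abs t]; nlinarith [abs_nonneg t]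
  have hI : Integrable (fun g => 4 * L^2 - t^2 - 2 * t * f g - f g^2 + 4 / L^2 * f g^4) ν :=
    ((((integrable_const _).sub (i1.const_mul _)).sub i2).add (i4.const_mul _))
  have hIv : ∫ g, (4 * L^2 - t^2 - 2 * t * f g - f g^2 + 4 / L^2 * f g^4) ∂ν
      = 4 * L^2 - t^2 - ∫ g, f g ^ 2 ∂ν + 4 / L^2 * ∫ g, f g ^ 4 ∂ν := by
    have j1 : Integrable (fun g => 4 * L^2 - t^2 - 2 * t * f g) ν :=
      (integrable_const _).sub (i1.const_mul _)
    have j2 : Integrable (fun g => 4 * L^2 - t^2 - 2 * t * f g - f g^2) ν := j1.sub i2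
    rw [integral_add j2 (i4.const_mul _), integral_sub j1 i2,
      integral_sub (integrable_const _) (i1.const_mul _), integral_const_mul, integral_const_mul, m0]
    simp
  have hle : ∫⁻ g, ENNReal.ofReal (max (4 * L^2 - (t + f g)^2) 0) ∂ν
      ≤ ENNReal.ofReal (4 * L^2 - t^2 - c) := by
    calc _ ≤ ∫⁻ g, ENNReal.ofReal
          (4 * L^2 - t^2 - 2 * t * f g - f g^2 + 4 / L^2 * f g^4) ∂ν :=
          lintegral_mono fun g => ENNReal.ofReal_le_ofReal (ew_real_ineq L t (f g) hL ht)
      _ = ENNReal.ofReal (∫ g, (4 * L^2 - t^2 - 2 * t * f g - f g^2 + 4 / L^2 * f g^4) ∂ν) := by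
          rw [ofReal_integral_eq_lintegral_ofReal hI]
          exact Eventually.of_forall fun g =>
            (le_max_right _ _).trans (ew_real_ineq L t (f g) hL ht)
      _ ≤ _ := by
          apply ENNReal.ofReal_le_ofReal
          rw [hIv]
          have : 4 / L^2 * ∫ g, f g ^ 4 ∂ν ≤ c := by
            rw [div_mul_eq_mul_div, div_le_iff₀ hL2]; linarith
          linarith
  have hnn : 0 ≤ 4 * L^2 - t^2 - c := by
    have h0 : 0 ≤ ∫ g, (4 * L^2 - t^2 - 2 * t * f g - f g^2 + 4 / L^2 * f g^4) ∂ν :=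
      integral_nonneg fun g => (le_max_right _ _).trans (ew_real_ineq L t (f g) hL ht)
    rw [hIv] at h0
    have : 4 / L^2 * ∫ g, f g ^ 4 ∂ν ≤ c := by
      rw [div_mul_eq_mul_div, div_le_iff₀ hL2]; linarith
    linarith
  calc _ ≤ ENNReal.ofReal c + ENNReal.ofReal (4 * L^2 - t^2 - c) := by gcongr
    _ = ENNReal.ofReal (4 * L^2 - t^2) := by
        rw [← ENNReal.ofReal_add hc.le hnn]; congr 1; ring
    _ ≤ _ := ENNReal.ofReal_le_ofReal (le_max_left _ _)

lemma ew_stay (hact : Measurable fun p : G × X => p.1 • p.2)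
    (σ : G → X → ℝ) (hσmeas : Measurable fun p : G × X => σ p.1 p.2)
    (hcoc : ∀ g₁ g₂ : G, ∀ x : X, σ (g₂ * g₁) x = σ g₂ (g₁ • x) + σ g₁ x)
    (μ : Measure G) [IsProbabilityMeasure μ]
    (β : Measure (ℕ → G)) [IsProbabilityMeasure β]
    (hβ : ∀ n : ℕ, β.map (fun b (i : Fin n) => b i) = Measure.pi fun _ : Fin n => μ)
    (m : ℕ) (L c : ℝ)
    (hly : ∀ (y : X) (t : ℝ), |t| ≤ L → ENNReal.ofReal c +
      ∫⁻ g, ENNReal.ofReal (max (4 * L^2 - (t + σ g y)^2) 0) ∂(convPow μ m)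
      ≤ ENNReal.ofReal (max (4 * L^2 - t^2) 0)) (x : X) (n : ℕ) :
    (n : ℝ≥0∞) * (ENNReal.ofReal c * β {b | ∀ i ≤ n, |σ (prodRev b (m * i)) x| ≤ L})
      ≤ ENNReal.ofReal (4 * L^2) := by
  have hms : ∀ x, Measurable fun g => σ g x := fun x =>
    hσmeas.comp (measurable_id.prodMk measurable_const)
  have hma : ∀ x : X, Measurable fun g : G => g • x := fun x =>
    hact.comp (measurable_id.prodMk measurable_const)
  let S : ℕ → Set (ℕ → G) := fun j => {b | ∀ i ≤ j, |σ (prodRev b (m * i)) x| ≤ L}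
  have hS : ∀ j, MeasurableSet (S j) := by
    intro j
    simp only [S, Set.setOf_forall]
    refine MeasurableSet.iInter fun i => MeasurableSet.iInter fun _ => ?_
    exact measurableSet_le (((hms x).comp (ew_meas_prodRev _)).abs) measurable_const
  have hSanti : ∀ i j, i ≤ j → S j ⊆ S i := fun i j hij b hb r hr => hb r (hr.trans hij)
  let F : ℝ → ℝ≥0∞ := fun t => ENNReal.ofReal (max (4 * L^2 - t^2) 0)
  have hF : Measurable F := by fun_prop
  let a : ℕ → ℝ≥0∞ := fun j => ∫⁻ b in S j, F (σ (prodRev b (m * j)) x) ∂β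
  have step : ∀ j, ENNReal.ofReal c * β (S j) + a (j+1) ≤ a j := by
    intro j
    have hΦm : Measurable fun p : (ℕ → G) × G =>
        F (σ (prodRev p.1 (m*j)) x + σ p.2 (prodRev p.1 (m*j) • x)) := by
      refine hF.comp (Measurable.add ?_ ?_)
      · exact (hms x).comp ((ew_meas_prodRev _).comp measurable_fst)
      · exact hσmeas.comp (measurable_snd.prodMk
          ((hma x).comp ((ew_meas_prodRev _).comp measurable_fst)))
    have hind : Measurable fun p : (ℕ → G) × G =>
        (S j).indicator (fun _ => (1 : ℝ≥0∞)) p.1 :=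
      (measurable_const.indicator (hS j)).comp measurable_fst
    have hb := ew_block_step μ β hβ (m*j) m
      (fun b g => (S j).indicator (fun _ => (1 : ℝ≥0∞)) b *
        F (σ (prodRev b (m*j)) x + σ g (prodRev b (m*j) • x)))
      (hind.mul hΦm)
      (by
        intro b b' h g
        have hpr : ∀ i ≤ j, prodRev b (m*i) = prodRev b' (m*i) := fun i hi =>
          ew_prodRev_congr _ _ _ fun r hr => h r (hr.trans_le (Nat.mul_le_mul_left m hi))
        have hiff : b ∈ S j ↔ b' ∈ S j := by
          constructor
          · intro hh i hi; rw [← hpr i hi]; exact hh i hi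
          · intro hh i hi; rw [hpr i hi]; exact hh i hi
        have : (S j).indicator (fun _ => (1 : ℝ≥0∞)) b
            = (S j).indicator (fun _ => (1 : ℝ≥0∞)) b' := by
          by_cases hh : b ∈ S j
          · rw [Set.indicator_of_mem hh, Set.indicator_of_mem (hiff.1 hh)]
          · rw [Set.indicator_of_notMem hh, Set.indicator_of_notMem (fun h' => hh (hiff.2 h'))]
        rw [this, hpr j le_rfl])
    have ha1 : a (j+1) ≤ ∫⁻ b, (S j).indicator (fun _ => (1 : ℝ≥0∞)) b *
        F (σ (prodRev b (m*j)) x + σ (prodRev (fun i => b (m*j+i)) m) (prodRev b (m*j) • x)) ∂β := by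
      calc a (j+1) ≤ ∫⁻ b in S j, F (σ (prodRev b (m*(j+1))) x) ∂β :=
            lintegral_mono_set (hSanti _ _ (Nat.le_succ j))
        _ = _ := by
            rw [← lintegral_indicator (hS j)]
            refine lintegral_congr fun b => ?_
            by_cases hh : b ∈ S j
            · rw [Set.indicator_of_mem hh, Set.indicator_of_mem hh, one_mul, Nat.mul_succ,
                ew_prodRev_add, hcoc, add_comm]
            · rw [Set.indicator_of_notMem hh, Set.indicator_of_notMem hh, zero_mul]
    rw [hb] at ha1
    refine (add_le_add le_rfl ha1).trans ?_
    calc _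
      _ = ∫⁻ b, ((S j).indicator (fun _ => ENNReal.ofReal c) b +
          ∫⁻ g, (S j).indicator (fun _ => (1 : ℝ≥0∞)) b *
            F (σ (prodRev b (m*j)) x + σ g (prodRev b (m*j) • x)) ∂(convPow μ m)) ∂β := by
          rw [lintegral_add_left (measurable_const.indicator (hS j)),
            lintegral_indicator_const (hS j)]
      _ ≤ a j := by
          simp only [a]
          rw [← lintegral_indicator (hS j)]
          refine lintegral_mono fun b => ?_
          by_cases hh : b ∈ S j
          · simp only [Set.indicator_of_mem hh, one_mul]
            exact hly _ _ (hh j le_rfl)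
          · simp only [Set.indicator_of_notMem hh, zero_mul, lintegral_zero, add_zero, le_refl]
  have tel : ∀ j ≤ n, (j : ℝ≥0∞) * (ENNReal.ofReal c * β (S n)) + a j ≤ a 0 := by
    intro j
    induction j with
    | zero => intro _; simp
    | succ j ih =>
      intro hj
      calc _ = (j : ℝ≥0∞) * (ENNReal.ofReal c * β (S n))
            + (ENNReal.ofReal c * β (S n) + a (j+1)) := by push_cast; ring
        _ ≤ (j : ℝ≥0∞) * (ENNReal.ofReal c * β (S n))
            + (ENNReal.ofReal c * β (S j) + a (j+1)) := by
            gcongr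
            exact hSanti _ _ (by omega)
        _ ≤ (j : ℝ≥0∞) * (ENNReal.ofReal c * β (S n)) + a j := by gcongr; exact step j
        _ ≤ _ := ih (by omega)
  have h0 : a 0 ≤ ENNReal.ofReal (4 * L^2) := by
    calc a 0 ≤ ∫⁻ b in S 0, ENNReal.ofReal (4 * L^2) ∂β := by
          refine lintegral_mono fun b => ENNReal.ofReal_le_ofReal ?_
          exact max_le (by nlinarith [sq_nonneg (σ (prodRev b (m * 0)) x)]) (by positivity)
      _ ≤ ∫⁻ b, ENNReal.ofReal (4 * L^2) ∂β := setLIntegral_le_lintegral _ _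
      _ = _ := by simp
  exact (le_self_add.trans (tel n le_rfl)).trans h0

end ExitWindowHelpers

/-- the martingale leaves the window `[-k_s, l_s]` before time `s³`,
with probability tending to one. -/
theorem exit_window
    {G : Type*} [Group G] [MeasurableSpace G] [MeasurableMul₂ G]
    {X : Type*} [MetricSpace X] [CompactSpace X] [MeasurableSpace X] [BorelSpace X]
    [MulAction G X] (hact : Measurable fun p : G × X => p.1 • p.2)
    (σ : G → X → ℝ)
    (hσmeas : Measurable fun p : G × X => σ p.1 p.2)
    (hcoc : ∀ g₁ g₂ : G, ∀ x : X, σ (g₂ * g₁) x = σ g₂ (g₁ • x) + σ g₁ x)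
    (N : G → ℝ) (hN0 : ∀ g, 0 ≤ N g) (hNsub : ∀ g h : G, N (g * h) ≤ N g + N h)
    (hNσ : ∀ g x, |σ g x| ≤ N g)
    (μ : Measure G) [IsProbabilityMeasure μ]
    (hmom1 : Integrable N μ)
    (hdrift : ∀ x, ∫ g, σ g x ∂μ = 0)
    (hexp : ∃ s > (0 : ℝ), Integrable (fun g => Real.exp (s * N g)) μ)
    (hcont : ∀ g, Continuous (σ g))
    (hXctrl : ∀ ε > (0 : ℝ), ∃ R > (0 : ℝ), ∀ n : ℕ, 1 ≤ n → ∀ x y : X,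
      ENNReal.ofReal (1 - ε) ≤ convPow μ n {g | |σ g x - σ g y| ≤ R})
    (A : ℝ) (hApos : 0 < A)
    (hA : ∀ ε > (0 : ℝ), ∃ n₀ : ℕ, ∀ n ≥ n₀, ∀ x : X,
      |(n : ℝ)⁻¹ * (∫ g, (σ g x) ^ 2 ∂convPow μ n) - A| < ε)
    (β : Measure (ℕ → G)) [IsProbabilityMeasure β]
    (hβ : ∀ n : ℕ, β.map (fun b (i : Fin n) => b i) = Measure.pi fun _ : Fin n => μ)
    (k l : ℝ) (hk : 0 < k) (hl : 0 < l) (ks ls : ℝ → ℝ)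
    (hks : Tendsto (fun s => ks s / s) atTop (𝓝 k))
    (hls : Tendsto (fun s => ls s / s) atTop (𝓝 l)) :
    ∀ x : X,
      Tendsto (fun s : ℝ =>
          β {b | ∃ n : ℕ, 1 ≤ n ∧ (n : ℝ) ≤ s ^ 3 ∧
              (σ (prodRev b n) x < -(ks s) ∨ ls s < σ (prodRev b n) x)})
        atTop (𝓝 1) := by
  intro x
  have hms : ∀ x, Measurable fun g => σ g x := fun x =>
    hσmeas.comp (measurable_id.prodMk measurable_const)
  -- fourth moment of the cocycle under the law of one step
  obtain ⟨s₀, hs₀, hexp⟩ := hexp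
  have h4 : ∀ x, ∫⁻ g, ENNReal.ofReal (σ g x ^ 4) ∂μ ≤
      ENNReal.ofReal (∫ g, 24 / s₀^4 * Real.exp (s₀ * N g) ∂μ) := by
    intro x
    rw [ofReal_integral_eq_lintegral_ofReal (hexp.const_mul _)
      (Eventually.of_forall fun g => by positivity)]
    refine lintegral_mono fun g => ENNReal.ofReal_le_ofReal ?_
    have e1 := Real.pow_div_factorial_le_exp (s₀ * N g) (mul_nonneg hs₀.le (hN0 g)) 4
    have e2 : σ g x ^ 4 ≤ N g ^ 4 := by
      have : σ g x ^ 4 = |σ g x| ^ 4 := by rw [Even.pow_abs (by decide)]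
      rw [this]
      exact pow_le_pow_left₀ (abs_nonneg _) (hNσ g x) 4
    have e3 : (Nat.factorial 4 : ℝ) = 24 := by norm_num [Nat.factorial]
    rw [e3, div_le_iff₀ (by norm_num), mul_pow] at e1
    refine e2.trans ?_
    rw [div_mul_eq_mul_div, le_div_iff₀ (by positivity)]
    linarith
  have hfour := ew_fourth hact σ hσmeas hcoc μ _ ENNReal.ofReal_ne_top h4
  have hint : ∀ m x, Integrable (fun g => σ g x ^ 4) (convPow μ m) ∧
      Integrable (fun g => σ g x ^ 2) (convPow μ m) ∧
      Integrable (fun g => σ g x) (convPow μ m) := by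
    intro m x
    obtain ⟨K', hK', h⟩ := hfour m
    exact ew_integrable4 _ _ (hms x) ((h x).trans_lt (lt_top_iff_ne_top.2 hK')).ne
  have hint1 : ∀ x, Integrable (fun g => σ g x) μ := fun x =>
    (ew_integrable4 μ _ (hms x) ((h4 x).trans_lt ENNReal.ofReal_lt_top).ne).2.2
  have hmean := ew_mean hact σ hσmeas hcoc μ (fun m x => (hint m x).2.2) hint1 hdrift
  -- choose the block length
  obtain ⟨n₀, hn₀⟩ := hA (A/2) (by positivity)
  obtain ⟨m, hm1, hmA⟩ : ∃ m : ℕ, 1 ≤ m ∧ ∀ y : X, 2 * (m * A / 4) ≤ ∫ g, σ g y ^ 2 ∂convPow μ m := by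
    refine ⟨max n₀ 1, le_max_right _ _, fun y => ?_⟩
    have h := hn₀ (max n₀ 1) (le_max_left _ _) y
    have hp : (0:ℝ) < ((max n₀ 1 : ℕ) : ℝ) := by exact_mod_cast (lt_max_of_lt_right Nat.one_pos)
    generalize ((max n₀ 1 : ℕ) : ℝ) = r at h hp ⊢
    rw [abs_lt] at h
    have h1 : A / 2 ≤ r⁻¹ * ∫ g, σ g y ^ 2 ∂convPow μ (max n₀ 1) := by linarith
    rw [inv_mul_eq_div, le_div_iff₀ hp] at h1
    linarith
  have hmpos : (0:ℝ) < m := by exact_mod_cast hm1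
  set c : ℝ := m * A / 4 with hc
  have hcpos : 0 < c := by positivity
  obtain ⟨K', hK', hKb⟩ := hfour m
  have hK4 : ∀ y, ∫ g, σ g y ^ 4 ∂convPow μ m ≤ K'.toReal := by
    intro y
    rw [integral_eq_lintegral_of_nonneg_ae (Eventually.of_forall fun g => by positivity)
      (hint m y).1.aestronglyMeasurable]
    exact ENNReal.toReal_mono hK' (hKb y)
  have hstay : ∀ L : ℝ, 0 < L → 4 * K'.toReal ≤ c * L^2 → ∀ n : ℕ,
      (n : ℝ≥0∞) * (ENNReal.ofReal c * β {b | ∀ i ≤ n, |σ (prodRev b (m * i)) x| ≤ L})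
      ≤ ENNReal.ofReal (4 * L^2) := fun L hL hKL n =>
    ew_stay hact σ hσmeas hcoc μ β hβ m L c (fun y t ht =>
      ew_lyap _ _ (hms y) K'.toReal c L t hL ht hcpos (hint m y).1 (hint m y).2.1 (hint m y).2.2
        (hmean m y) (hmA y) (hK4 y) hKL) x n
  set C : ℝ := k + l + 1 with hC
  have hCpos : 0 < C := by positivity
  have hEmeas : ∀ s : ℝ, MeasurableSet {b : ℕ → G | ∃ n : ℕ, 1 ≤ n ∧ (n : ℝ) ≤ s ^ 3 ∧
      (σ (prodRev b n) x < -(ks s) ∨ ls s < σ (prodRev b n) x)} := by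
    intro s
    have hmn : ∀ n, Measurable fun b : ℕ → G => σ (prodRev b n) x := fun n =>
      (hms x).comp (ew_meas_prodRev n)
    simp only [Set.setOf_exists]
    refine MeasurableSet.iUnion fun n => ?_
    refine (MeasurableSet.const _).inter ((MeasurableSet.const _).inter ?_)
    exact (measurableSet_lt (hmn n) measurable_const).union
      (measurableSet_lt measurable_const (hmn n))
  -- the complement has small probability
  have hbound : ∀ᶠ s : ℝ in atTop,
      β {b : ℕ → G | ∃ n : ℕ, 1 ≤ n ∧ (n : ℝ) ≤ s ^ 3 ∧
        (σ (prodRev b n) x < -(ks s) ∨ ls s < σ (prodRev b n) x)}ᶜ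
        ≤ ENNReal.ofReal ((8 * C^2 * m / c) / s) := by
    have e1 : ∀ᶠ s in atTop, ks s / s < C := hks.eventually_lt_const (by linarith)
    have e2 : ∀ᶠ s in atTop, ls s / s < C := hls.eventually_lt_const (by linarith)
    have e3 : ∀ᶠ s : ℝ in atTop, 4 * K'.toReal ≤ c * (C * s)^2 := by
      have : Tendsto (fun s : ℝ => c * (C * s)^2) atTop atTop :=
        Tendsto.const_mul_atTop hcpos
          ((tendsto_pow_atTop (by norm_num)).comp (tendsto_id.const_mul_atTop hCpos))
      exact this.eventually_ge_atTop _
    filter_upwards [e1, e2, e3, eventually_ge_atTop (1:ℝ), eventually_ge_atTop (2 * m : ℝ)]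
      with s h1 h2 h3 h4 h5
    have hs : 0 < s := by linarith
    rw [div_lt_iff₀ hs] at h1 h2
    set n : ℕ := ⌊s^3 / m⌋₊ with hn
    have hnle : (m : ℝ) * n ≤ s^3 := by
      have := Nat.floor_le (show 0 ≤ s^3 / m by positivity)
      rw [← hn, le_div_iff₀ hmpos] at this
      linarith
    have hnge : s^3 / (2 * m) ≤ n := by
      have := Nat.lt_floor_add_one (s^3 / m)
      rw [← hn] at this
      have h6 : 1 ≤ s^3 / (2 * m) := by
        rw [le_div_iff₀ (by positivity)]
        nlinarith [mul_pos hs hs]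
      have h7 : s^3 / m = 2 * (s^3 / (2 * m)) := by field_simp
      linarith
    have hsub : {b : ℕ → G | ∃ n : ℕ, 1 ≤ n ∧ (n : ℝ) ≤ s ^ 3 ∧
        (σ (prodRev b n) x < -(ks s) ∨ ls s < σ (prodRev b n) x)}ᶜ ⊆
        {b | ∀ i ≤ n, |σ (prodRev b (m * i)) x| ≤ C * s} := by
      intro b hb i hi
      rcases Nat.eq_zero_or_pos i with h0 | h0
      · have hz : σ 1 x = 0 := by have := hcoc 1 1 x; simp at this; exact this
        subst h0
        simp only [Nat.mul_zero, prodRev, hz, abs_zero]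
        positivity
      · have hb' : ¬ (σ (prodRev b (m*i)) x < -(ks s) ∨ ls s < σ (prodRev b (m*i)) x) := by
          intro hh
          refine hb ⟨m * i, Nat.mul_pos hm1 h0, ?_, hh⟩
          push_cast
          have : (i:ℝ) ≤ n := by exact_mod_cast hi
          nlinarith
        push Not at hb'
        rw [abs_le]
        constructor <;> linarith [hb'.1, hb'.2]
    have hL := hstay (C * s) (by positivity) h3 n
    have hP : β {b : ℕ → G | ∀ i ≤ n, |σ (prodRev b (m * i)) x| ≤ C * s} ≠ ∞ := measure_ne_top _ _
    refine (measure_mono hsub).trans ?_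
    generalize β {b : ℕ → G | ∀ i ≤ n, |σ (prodRev b (m * i)) x| ≤ C * s} = P at hL hP ⊢
    rw [ENNReal.le_ofReal_iff_toReal_le hP (by positivity)]
    have hL' := ENNReal.toReal_mono ENNReal.ofReal_ne_top hL
    rw [ENNReal.toReal_mul, ENNReal.toReal_mul, ENNReal.toReal_ofReal hcpos.le,
      ENNReal.toReal_ofReal (by positivity), ENNReal.toReal_natCast] at hL'
    have hp0 : 0 ≤ P.toReal := ENNReal.toReal_nonneg
    have h8 : s^3 / (2*m) * (c * P.toReal) ≤ 4 * (C * s)^2 :=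
      (mul_le_mul_of_nonneg_right hnge (by positivity)).trans hL'
    have h9 : 8 * C^2 * m / c / s = 4 * (C * s)^2 / (s^3 / (2*m) * c) := by
      field_simp
      ring
    rw [h9, le_div_iff₀ (by positivity)]
    linarith
  have hlim : Tendsto (fun s : ℝ => ENNReal.ofReal ((8 * C^2 * m / c) / s)) atTop (𝓝 0) := by
    have := ENNReal.tendsto_ofReal (tendsto_const_nhds.div_atTop tendsto_id :
      Tendsto (fun s : ℝ => (8 * C^2 * m / c) / s) atTop (𝓝 0))
    simpa using this
  have hcompl : Tendsto (fun s : ℝ => β {b : ℕ → G | ∃ n : ℕ, 1 ≤ n ∧ (n : ℝ) ≤ s ^ 3 ∧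
        (σ (prodRev b n) x < -(ks s) ∨ ls s < σ (prodRev b n) x)}ᶜ) atTop (𝓝 0) :=
    tendsto_of_tendsto_of_tendsto_of_le_of_le' tendsto_const_nhds hlim
      (Eventually.of_forall fun _ => zero_le) hbound
  have hfin := ENNReal.Tendsto.sub (tendsto_const_nhds (x := (1:ℝ≥0∞))) hcompl
    (Or.inl ENNReal.one_ne_top)
  rw [tsub_zero] at hfin
  refine hfin.congr fun s => ?_
  rw [← prob_compl_eq_one_sub (hEmeas s).compl, compl_compl]
end
end

section
/- Assume d = 1, μ has finite second moment, and σ is X-controlled. Then there exist x₀ ∈ X and A ≥ 0 such that (1/n) ∫_G σ(g,x₀)² dμ^{*n}(g) → A as n → ∞, and the law of σ(g,x₀)/√n under μ^{*n} converges weakly to the centered Gaussian distribution 𝒩(0,A) on ℝ. -/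
open MeasureTheory Filter Topology
open scoped ENNReal NNReal

noncomputable section

set_option linter.unusedSectionVars false

namespace CLTAux

/-- A centered cocycle dominated by a square-integrable function. -/
structure IsZC {G Z : Type*} [Group G] [MeasurableSpace G] [MeasurableSpace Z] [MulAction G Z]
    (μ : Measure G) (τ : G → Z → ℝ) (K : G → ℝ) : Prop where
  act : Measurable fun p : G × Z => p.1 • p.2
  meas : Measurable fun p : G × Z => τ p.1 p.2
  coc : ∀ g₁ g₂ : G, ∀ x : Z, τ (g₂ * g₁) x = τ g₂ (g₁ • x) + τ g₁ x
  dom : ∀ g x, |τ g x| ≤ K g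
  int2 : Integrable (fun g => K g ^ 2) μ
  drift : ∀ x, ∫ g, τ g x ∂μ = 0

section basics

variable {G : Type*} [Group G] [MeasurableSpace G] [MeasurableMul₂ G]
  {μ : Measure G} [IsProbabilityMeasure μ]

instance convPow_prob (n : ℕ) : IsProbabilityMeasure (convPow μ n) := by
  induction n with
  | zero => unfold convPow; infer_instance
  | succ n ih =>
    unfold convPow
    exact Measure.isProbabilityMeasure_map (by fun_prop)

lemma convPow_succ (n : ℕ) : convPow μ (n + 1) = Measure.mconv μ (convPow μ n) := rfl

lemma convPow_one : convPow μ 1 = μ := by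
  rw [convPow_succ]
  exact Measure.mconv_dirac_one μ

lemma convPow_add (m n : ℕ) :
    convPow μ (m + n) = Measure.mconv (convPow μ m) (convPow μ n) := by
  induction m with
  | zero =>
    rw [Nat.zero_add]
    exact (Measure.dirac_one_mconv _).symm
  | succ m ih =>
    rw [show m + 1 + n = (m + n) + 1 by ring, convPow_succ, ih, convPow_succ, Measure.mconv_assoc]

lemma integrable_add {E : Type*} [NormedAddCommGroup E] {m n : ℕ} {F : G → E}
    (hF : Integrable F (convPow μ (m + n))) :
    Integrable (fun p : G × G => F (p.1 * p.2)) ((convPow μ m).prod (convPow μ n)) := by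
  rw [convPow_add, Measure.mconv] at hF
  exact hF.comp_measurable (by fun_prop)

lemma integral_add {E : Type*} [NormedAddCommGroup E] [NormedSpace ℝ E] [CompleteSpace E]
    {m n : ℕ} {F : G → E} (hF : Integrable F (convPow μ (m + n))) :
    ∫ g, F g ∂convPow μ (m + n) = ∫ h, ∫ g, F (g * h) ∂convPow μ m ∂convPow μ n := by
  have h1 := integrable_add hF
  rw [convPow_add, Measure.mconv] at hF ⊢
  rw [integral_map (by fun_prop) hF.aestronglyMeasurable]
  exact integral_prod_symm _ h1

end basics

section coc

variable {G Z : Type*} [Group G] [MeasurableSpace G] [MeasurableMul₂ G] [MeasurableSpace Z]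
  [MulAction G Z] {μ : Measure G} [IsProbabilityMeasure μ] {τ : G → Z → ℝ} {K : G → ℝ}

lemma IsZC.meas1 (H : IsZC μ τ K) (x : Z) : Measurable fun g => τ g x :=
  H.meas.comp (measurable_id.prodMk measurable_const)

lemma IsZC.act1 (H : IsZC μ τ K) (x : Z) : Measurable fun g : G => g • x :=
  H.act.comp (measurable_id.prodMk measurable_const)

lemma IsZC.meas2 (H : IsZC μ τ K) (x : Z) : Measurable fun p : G × G => τ p.1 (p.2 • x) :=
  H.meas.comp (measurable_fst.prodMk ((H.act1 x).comp measurable_snd))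

lemma IsZC.sq_le (H : IsZC μ τ K) (g : G) (x : Z) : τ g x ^ 2 ≤ K g ^ 2 := by
  rw [← sq_abs (τ g x)]
  exact pow_le_pow_left₀ (abs_nonneg _) (H.dom g x) 2

lemma IsZC.sqint (H : IsZC μ τ K) (x : Z) (n : ℕ) :
    Integrable (fun g => τ g x ^ 2) (convPow μ n) := by
  induction n with
  | zero =>
    unfold convPow
    exact integrable_dirac' (((H.meas1 x).pow_const 2).stronglyMeasurable) (by simp)
  | succ n ih =>
    rw [convPow_succ, Measure.mconv,
      integrable_map_measure ((H.meas1 x).pow_const 2).aestronglyMeasurable (by fun_prop)]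
    have h1 : Integrable (fun p : G × G => 2 * (K p.1 ^ 2 + τ p.2 x ^ 2))
        (μ.prod (convPow μ n)) :=
      ((H.int2.comp_fst _).add (ih.comp_snd _)).const_mul 2
    refine h1.mono' (((H.meas1 x).pow_const 2).comp measurable_mul).aestronglyMeasurable
      (ae_of_all _ fun p => ?_)
    simp only [Function.comp, H.coc]
    rw [Real.norm_eq_abs, abs_of_nonneg (sq_nonneg _)]
    nlinarith [H.sq_le p.1 (p.2 • x), sq_nonneg (τ p.1 (p.2 • x) - τ p.2 x)]

lemma IsZC.memLp (H : IsZC μ τ K) (x : Z) (n : ℕ) : MemLp (fun g => τ g x) 2 (convPow μ n) :=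
  (memLp_two_iff_integrable_sq (H.meas1 x).aestronglyMeasurable).2 (H.sqint x n)

lemma IsZC.int (H : IsZC μ τ K) (x : Z) (n : ℕ) : Integrable (fun g => τ g x) (convPow μ n) :=
  (H.memLp x n).integrable (by norm_num)

lemma IsZC.mean (H : IsZC μ τ K) (x : Z) (n : ℕ) : ∫ g, τ g x ∂convPow μ n = 0 := by
  induction n with
  | zero =>
    unfold convPow
    rw [integral_dirac' _ _ (H.meas1 x).stronglyMeasurable]
    have := H.coc 1 1 x
    simp at this
    exact this
  | succ n ih =>
    rw [Nat.add_comm n 1, integral_add (H.int x _), convPow_one, ← ih]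
    congr 1
    ext h
    simp only [H.coc]
    have hi := H.int (h • x) 1
    rw [convPow_one] at hi
    rw [MeasureTheory.integral_add hi (integrable_const _), H.drift]
    simp

/-- second moment -/
def vv (μ : Measure G) (τ : G → Z → ℝ) (n : ℕ) (x : Z) : ℝ := ∫ g, τ g x ^ 2 ∂convPow μ n

lemma IsZC.vv_inner (H : IsZC μ τ K) (m : ℕ) (x : Z) (h : G) :
    ∫ g, τ (g * h) x ^ 2 ∂convPow μ m = vv μ τ m (h • x) + τ h x ^ 2 := by
  have e : ∀ g, τ (g * h) x ^ 2 = τ g (h • x) ^ 2 + ((2 * τ h x) * τ g (h • x) + τ h x ^ 2) := by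
    intro g; rw [H.coc]; ring
  simp only [e]
  have i1 : Integrable (fun g => (2 * τ h x) * τ g (h • x)) (convPow μ m) :=
    (H.int _ _).const_mul _
  have i2 : Integrable (fun g => (2 * τ h x) * τ g (h • x) + τ h x ^ 2) (convPow μ m) :=
    i1.add (integrable_const _)
  rw [MeasureTheory.integral_add (H.sqint _ _) i2,
    MeasureTheory.integral_add i1 (integrable_const _), integral_const_mul, H.mean]
  simp [vv]

lemma IsZC.vv_int (H : IsZC μ τ K) (m n : ℕ) (x : Z) :
    Integrable (fun h => vv μ τ m (h • x)) (convPow μ n) := by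
  have h1 := (integrable_add (H.sqint x (m + n))).integral_prod_right
  simp only [H.vv_inner] at h1
  refine (h1.sub (H.sqint x n)).congr (ae_of_all _ fun h => ?_)
  simp

lemma IsZC.vv_add (H : IsZC μ τ K) (m n : ℕ) (x : Z) :
    vv μ τ (m + n) x = vv μ τ n x + ∫ h, vv μ τ m (h • x) ∂convPow μ n := by
  rw [vv, integral_add (H.sqint x _)]
  simp only [H.vv_inner]
  rw [MeasureTheory.integral_add (H.vv_int m n x) (H.sqint x n), add_comm]
  rfl

lemma vv_nonneg (m : ℕ) (x : Z) : 0 ≤ vv μ τ m x := integral_nonneg fun _ => sq_nonneg _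

lemma IsZC.vv_one (H : IsZC μ τ K) (x : Z) : vv μ τ 1 x ≤ ∫ g, K g ^ 2 ∂μ := by
  have h := H.sqint x 1
  rw [vv]
  rw [convPow_one] at h ⊢
  exact integral_mono h H.int2 fun g => H.sq_le g x

lemma IsZC.vv_zero (H : IsZC μ τ K) (x : Z) : vv μ τ 0 x = 0 := by
  unfold vv convPow
  rw [integral_dirac' _ _ ((H.meas1 x).pow_const 2).stronglyMeasurable]
  have := H.coc 1 1 x
  simp at this
  simp [this]

lemma integral_le_const {ν : Measure G} [IsProbabilityMeasure ν] {f : G → ℝ} {c : ℝ}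
    (hf : Integrable f ν) (h : ∀ g, f g ≤ c) : ∫ g, f g ∂ν ≤ c := by
  calc ∫ g, f g ∂ν ≤ ∫ _, c ∂ν := integral_mono hf (integrable_const _) h
    _ = c := by simp

lemma IsZC.vv_le (H : IsZC μ τ K) (n : ℕ) (x : Z) :
    vv μ τ n x ≤ n * ∫ g, K g ^ 2 ∂μ := by
  induction n with
  | zero => simp [H.vv_zero]
  | succ n ih =>
    rw [Nat.add_comm n 1, H.vv_add]
    have := integral_le_const (H.vv_int 1 n x) (fun g => H.vv_one (g • x))
    push_cast
    linarith

/-- smooth truncation of the square -/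
def Ph (C s : ℝ) : ℝ := s ^ 4 / (C + s ^ 2)

lemma Ph_nonneg {C : ℝ} (hC : 0 < C) (s : ℝ) : 0 ≤ Ph C s := by unfold Ph; positivity

lemma Ph_le {C : ℝ} (hC : 0 < C) (s : ℝ) : Ph C s ≤ s ^ 2 := by
  unfold Ph
  rw [div_le_iff₀ (by positivity)]
  nlinarith [mul_nonneg hC.le (sq_nonneg s)]

lemma Ph_taylor {C : ℝ} (hC : 0 < C) (s v : ℝ) :
    Ph C (s + v) = Ph C s + (2 * s - 2 * C ^ 2 * s / (C + s ^ 2) ^ 2) * v + v ^ 2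
      + v ^ 2 * (C ^ 2 * (3 * s ^ 2 + 2 * s * v - C) / ((C + s ^ 2) ^ 2 * (C + (s + v) ^ 2))) := by
  unfold Ph
  have h1 : C + s ^ 2 ≠ 0 := by positivity
  have h2 : C + (s + v) ^ 2 ≠ 0 := by positivity
  field_simp
  ring

lemma Ph_rem1 {C : ℝ} (hC : 0 < C) (s v : ℝ) :
    C ^ 2 * (3 * s ^ 2 + 2 * s * v - C) / ((C + s ^ 2) ^ 2 * (C + (s + v) ^ 2)) ≤ 2 := by
  rw [div_le_iff₀ (by positivity)]
  have e : 3 * s ^ 2 + 2 * s * v - C ≤ 2 * s ^ 2 + (s + v) ^ 2 := by nlinarith [sq_nonneg v]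
  have h3 : C ^ 2 * (2 * s ^ 2 + (s + v) ^ 2) ≤ 2 * ((C + s ^ 2) ^ 2 * (C + (s + v) ^ 2)) := by
    have hw := sq_nonneg (s + v)
    have hS := sq_nonneg s
    generalize (s + v) ^ 2 = w at *
    generalize s ^ 2 = S at *
    have : 0 ≤ 2 * C ^ 3 + 2 * C ^ 2 * S + C ^ 2 * w + 4 * C * S * w + 2 * S ^ 2 * (C + w) := by
      positivity
    nlinarith
  nlinarith [mul_le_mul_of_nonneg_left e (sq_nonneg C)]

lemma Ph_rem2 {C : ℝ} (hC : 0 < C) (s v : ℝ) :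
    1 + C ^ 2 * (3 * s ^ 2 + 2 * s * v - C) / ((C + s ^ 2) ^ 2 * (C + (s + v) ^ 2))
      ≤ (8 * s ^ 2 + 3 * v ^ 2) / C := by
  have hw := sq_nonneg (s + v)
  have hS := sq_nonneg s
  have hV := sq_nonneg v
  have hw2 : (s + v) ^ 2 ≤ 2 * s ^ 2 + 2 * v ^ 2 := by nlinarith [sq_nonneg (s - v)]
  have hsv : 2 * s * v ≤ s ^ 2 + v ^ 2 := by nlinarith [sq_nonneg (s - v)]
  have hpos : 0 < (C + s ^ 2) ^ 2 * (C + (s + v) ^ 2) := by positivity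
  rw [one_add_div hpos.ne', div_le_div_iff₀ hpos hC]
  have h1 : C ^ 2 * (3 * s ^ 2 + 2 * s * v - C) ≤ C ^ 2 * (4 * s ^ 2 + v ^ 2 - C) :=
    mul_le_mul_of_nonneg_left (by linarith) (sq_nonneg C)
  generalize 3 * s ^ 2 + 2 * s * v - C = P at *
  generalize (s + v) ^ 2 = w at *
  generalize s ^ 2 = S at *
  generalize v ^ 2 = V at *
  have h2 : ((C + S) ^ 2 * (C + w) + C ^ 2 * P) * C
      ≤ ((C + S) ^ 2 * (C + w) + C ^ 2 * (4 * S + V - C)) * C :=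
    mul_le_mul_of_nonneg_right (by linarith) hC.le
  have h3 : ((C + S) ^ 2 * (C + w) + C ^ 2 * (4 * S + V - C)) * C
      ≤ (6 * S + V + w) * ((C + S) ^ 2 * (C + w)) := by
    have : 0 ≤ C ^ 2 * (4 * S + V) * w + (4 * S + V) * (2 * C * S + S ^ 2) * (C + w)
      + w * (C ^ 2 * w + (2 * C * S + S ^ 2) * (C + w))
      + (3 * C * S ^ 2 + 2 * S ^ 3) * (C + w) := by positivity
    nlinarith
  have h4 : (6 * S + V + w) * ((C + S) ^ 2 * (C + w))
      ≤ (8 * S + 3 * V) * ((C + S) ^ 2 * (C + w)) :=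
    mul_le_mul_of_nonneg_right (by linarith) hpos.le
  linarith

/-- tail function -/
def tl (L k : ℝ) : ℝ := if L < k then k else 0

lemma tl_meas (L : ℝ) : Measurable (tl L) :=
  Measurable.ite measurableSet_Ioi measurable_id measurable_const

lemma tl_nonneg {L k : ℝ} (hk : 0 ≤ k) : 0 ≤ tl L k := by unfold tl; split_ifs <;> simp [hk]

lemma tl_le {L k : ℝ} (hk : 0 ≤ k) : tl L k ≤ k := by unfold tl; split_ifs <;> simp [hk]

lemma tl_int {Ω : Type*} [MeasurableSpace Ω] {ν : Measure Ω} {f : Ω → ℝ} (hf : Integrable f ν)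
    (h0 : ∀ a, 0 ≤ f a) (L : ℝ) : Integrable (fun a => tl L (f a)) ν := by
  refine hf.mono' ((tl_meas L).comp_aemeasurable hf.aemeasurable).aestronglyMeasurable
    (ae_of_all _ fun a => ?_)
  rw [Real.norm_eq_abs, abs_of_nonneg (tl_nonneg (h0 a))]
  exact tl_le (h0 a)

lemma tl_small {Ω : Type*} [MeasurableSpace Ω] {ν : Measure Ω} {f : Ω → ℝ} (hf : Integrable f ν)
    (h0 : ∀ a, 0 ≤ f a) {ε : ℝ} (hε : 0 < ε) : ∃ L : ℝ, 0 < L ∧ ∫ a, tl L (f a) ∂ν < ε := by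
  have h : Tendsto (fun n : ℕ => ∫ a, tl n (f a) ∂ν) atTop (𝓝 (∫ _, (0 : ℝ) ∂ν)) := by
    refine tendsto_integral_of_dominated_convergence f
      (fun n => (tl_int hf h0 n).aestronglyMeasurable) hf
      (fun n => ae_of_all _ fun a => ?_) (ae_of_all _ fun a => ?_)
    · rw [Real.norm_eq_abs, abs_of_nonneg (tl_nonneg (h0 a))]
      exact tl_le (h0 a)
    · refine tendsto_const_nhds.congr' ?_
      filter_upwards [eventually_ge_atTop ⌈f a⌉₊] with n hn
      have : f a ≤ n := (Nat.le_ceil _).trans (by exact_mod_cast hn)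
      simp [tl, this]
  rw [integral_zero] at h
  obtain ⟨n, hn, hn0⟩ := ((h.eventually (gt_mem_nhds hε)).and (eventually_gt_atTop 0)).exists
  exact ⟨n, by exact_mod_cast hn0, hn⟩

lemma Ph_step {C : ℝ} (hC : 0 < C) {L : ℝ} (hL : 0 ≤ L) (s v k : ℝ) (hv : v ^ 2 ≤ k) :
    Ph C (s + v) ≤ Ph C s + (2 * s - 2 * C ^ 2 * s / (C + s ^ 2) ^ 2) * v
      + L * (8 * s ^ 2 + 3 * L) / C + 3 * tl L k := by
  rw [Ph_taylor hC]
  have r1 := Ph_rem1 hC s v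
  have r2 := Ph_rem2 hC s v
  generalize C ^ 2 * (3 * s ^ 2 + 2 * s * v - C) / ((C + s ^ 2) ^ 2 * (C + (s + v) ^ 2)) = r at *
  have hv0 := sq_nonneg v
  by_cases h : L < k
  · have : 0 ≤ L * (8 * s ^ 2 + 3 * L) / C := by positivity
    simp only [tl, h, if_true]
    nlinarith [mul_le_mul_of_nonneg_left r1 hv0]
  · push Not at h
    simp only [tl, not_lt.2 h, if_false]
    have hvL : v ^ 2 ≤ L := hv.trans h
    have h1 : v ^ 2 * (1 + r) ≤ v ^ 2 * ((8 * s ^ 2 + 3 * v ^ 2) / C) :=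
      mul_le_mul_of_nonneg_left r2 hv0
    have h2 : v ^ 2 * ((8 * s ^ 2 + 3 * v ^ 2) / C) ≤ L * ((8 * s ^ 2 + 3 * L) / C) := by
      gcongr
    have h3 : L * ((8 * s ^ 2 + 3 * L) / C) = L * (8 * s ^ 2 + 3 * L) / C := by ring
    linarith

lemma Ph_meas (C : ℝ) : Measurable (Ph C) := by unfold Ph; fun_prop

lemma IsZC.Ph_int (H : IsZC μ τ K) {C : ℝ} (hC : 0 < C) (n : ℕ) (x : Z) :
    Integrable (fun g => Ph C (τ g x)) (convPow μ n) := by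
  refine (H.sqint x n).mono' ((Ph_meas C).comp (H.meas1 x)).aestronglyMeasurable
    (ae_of_all _ fun g => ?_)
  rw [Real.norm_eq_abs, abs_of_nonneg (Ph_nonneg hC _)]
  exact Ph_le hC _

lemma IsZC.Ph_succ (H : IsZC μ τ K) {C : ℝ} (hC : 0 < C) {L : ℝ} (hL : 0 ≤ L) (n : ℕ) (x : Z) :
    ∫ g, Ph C (τ g x) ∂convPow μ (n + 1) ≤ ∫ g, Ph C (τ g x) ∂convPow μ n
      + (L * (8 * (n * ∫ g, K g ^ 2 ∂μ) + 3 * L) / C + 3 * ∫ g, tl L (K g ^ 2) ∂μ) := by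
  have hT := tl_int H.int2 (fun g => sq_nonneg (K g)) L
  have hI := H.Ph_int hC (1 + n) x
  have i1 := (integrable_add hI).integral_prod_right
  rw [Nat.add_comm n 1, integral_add hI]
  rw [convPow_one] at i1 ⊢
  have key : ∀ h : G, ∫ g, Ph C (τ (g * h) x) ∂μ
      ≤ Ph C (τ h x) + (L * (8 * τ h x ^ 2 + 3 * L) / C + 3 * ∫ g, tl L (K g ^ 2) ∂μ) := by
    intro h
    have j0 := H.int (h • x) 1
    rw [convPow_one] at j0
    have j1 : Integrable (fun g => Ph C (τ h x) +
        (2 * τ h x - 2 * C ^ 2 * τ h x / (C + τ h x ^ 2) ^ 2) * τ g (h • x)) μ :=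
      (integrable_const _).add (j0.const_mul _)
    have j2 : Integrable (fun g => Ph C (τ h x) +
        (2 * τ h x - 2 * C ^ 2 * τ h x / (C + τ h x ^ 2) ^ 2) * τ g (h • x)
        + L * (8 * τ h x ^ 2 + 3 * L) / C) μ := j1.add (integrable_const _)
    have j3 : Integrable (fun g => Ph C (τ h x) +
        (2 * τ h x - 2 * C ^ 2 * τ h x / (C + τ h x ^ 2) ^ 2) * τ g (h • x)
        + L * (8 * τ h x ^ 2 + 3 * L) / C + 3 * tl L (K g ^ 2)) μ := j2.add (hT.const_mul 3)
    have e : ∫ g, (Ph C (τ h x) +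
        (2 * τ h x - 2 * C ^ 2 * τ h x / (C + τ h x ^ 2) ^ 2) * τ g (h • x)
        + L * (8 * τ h x ^ 2 + 3 * L) / C + 3 * tl L (K g ^ 2)) ∂μ
        = Ph C (τ h x) + (L * (8 * τ h x ^ 2 + 3 * L) / C + 3 * ∫ g, tl L (K g ^ 2) ∂μ) := by
      rw [MeasureTheory.integral_add j2 (hT.const_mul 3),
        MeasureTheory.integral_add j1 (integrable_const _),
        MeasureTheory.integral_add (integrable_const _) (j0.const_mul _),
        integral_const_mul, integral_const_mul, H.drift]
      simp
      ring
    rw [← e]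
    refine integral_mono_of_nonneg (ae_of_all _ fun g => Ph_nonneg hC _) j3
      (ae_of_all _ fun g => ?_)
    simp only [H.coc]
    rw [add_comm]
    exact Ph_step hC hL _ _ _ (H.sq_le g (h • x))
  have k0 : Integrable (fun h => L * (8 * τ h x ^ 2 + 3 * L) / C) (convPow μ n) :=
    ((((H.sqint x n).const_mul 8).add (integrable_const _)).const_mul L).div_const C
  have k1 : Integrable (fun h => L * (8 * τ h x ^ 2 + 3 * L) / C
      + 3 * ∫ g, tl L (K g ^ 2) ∂μ) (convPow μ n) := k0.add (integrable_const _)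
  refine (integral_mono i1 ((H.Ph_int hC n x).add k1) key).trans ?_
  simp only [Pi.add_apply]
  rw [MeasureTheory.integral_add (H.Ph_int hC n x) k1,
    MeasureTheory.integral_add k0 (integrable_const _), integral_div, integral_const_mul,
    MeasureTheory.integral_add ((H.sqint x n).const_mul 8) (integrable_const _),
    integral_const_mul]
  have hv := H.vv_le n x
  unfold vv at hv
  simp only [integral_const, probReal_univ, one_smul]
  gcongr

lemma IsZC.Ph_bound (H : IsZC μ τ K) {C : ℝ} (hC : 0 < C) {L : ℝ} (hL : 0 ≤ L) (n : ℕ) (x : Z) :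
    ∫ g, Ph C (τ g x) ∂convPow μ n ≤
      n * (L * (8 * (n * ∫ g, K g ^ 2 ∂μ) + 3 * L) / C + 3 * ∫ g, tl L (K g ^ 2) ∂μ) := by
  have hB : 0 ≤ ∫ g, K g ^ 2 ∂μ := integral_nonneg fun _ => sq_nonneg _
  suffices h : ∀ k ≤ n, ∫ g, Ph C (τ g x) ∂convPow μ k ≤
      k * (L * (8 * (n * ∫ g, K g ^ 2 ∂μ) + 3 * L) / C + 3 * ∫ g, tl L (K g ^ 2) ∂μ) from
    h n le_rfl
  intro k
  induction k with
  | zero =>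
    intro _
    have h1 : ∫ g, Ph C (τ g x) ∂convPow μ 0 ≤ vv μ τ 0 x :=
      integral_mono (H.Ph_int hC 0 x) (H.sqint x 0) fun g => Ph_le hC _
    rw [H.vv_zero] at h1
    simpa using h1
  | succ k ih =>
    intro hk
    have h1 := H.Ph_succ hC hL k x
    have h2 := ih (by omega)
    have h3 : L * (8 * (k * ∫ g, K g ^ 2 ∂μ) + 3 * L) / C
        ≤ L * (8 * (n * ∫ g, K g ^ 2 ∂μ) + 3 * L) / C := by
      have : (k : ℝ) ≤ n := by exact_mod_cast (by omega : k ≤ n)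
      gcongr
    push_cast
    linarith

lemma tl_le_Ph {C : ℝ} (hC : 0 < C) (s : ℝ) : tl C (s ^ 2) ≤ 2 * Ph C s := by
  unfold tl
  split_ifs with h
  · unfold Ph
    rw [← mul_div_assoc, le_div_iff₀ (by positivity)]
    nlinarith [sq_nonneg s]
  · have := Ph_nonneg hC s
    linarith

/-- uniform integrability of `τ²/n` -/
lemma IsZC.UI (H : IsZC μ τ K) {ε : ℝ} (hε : 0 < ε) :
    ∃ Λ : ℝ, 0 < Λ ∧ ∀ n : ℕ, 1 ≤ n → ∀ x : Z,
      ∫ g, tl (Λ * n) (τ g x ^ 2) ∂convPow μ n ≤ ε * n := by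
  have hB : 0 ≤ ∫ g, K g ^ 2 ∂μ := integral_nonneg fun _ => sq_nonneg _
  obtain ⟨L, hL, hT⟩ := tl_small H.int2 (fun g => sq_nonneg (K g)) (show 0 < ε / 12 by positivity)
  generalize hBdef : ∫ g, K g ^ 2 ∂μ = B at *
  refine ⟨4 * (L * (8 * B + 3 * L)) / ε, by positivity, fun n hn x => ?_⟩
  have hn' : (1 : ℝ) ≤ n := by exact_mod_cast hn
  set C : ℝ := 4 * (L * (8 * B + 3 * L)) / ε * n with hCdef
  have hC : 0 < C := by positivity
  have h1 := H.Ph_bound hC hL.le n x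
  rw [hBdef] at h1
  have h2 : ∫ g, tl C (τ g x ^ 2) ∂convPow μ n ≤ 2 * ∫ g, Ph C (τ g x) ∂convPow μ n := by
    rw [← integral_const_mul]
    exact integral_mono (tl_int (H.sqint x n) (fun _ => sq_nonneg _) _)
      ((H.Ph_int hC n x).const_mul 2) fun g => tl_le_Ph hC _
  have h3 : L * (8 * (n * B) + 3 * L) / C ≤ ε / 4 := by
    rw [div_le_iff₀ hC]
    have : ε / 4 * C = L * (8 * B + 3 * L) * n := by rw [hCdef]; field_simp
    rw [this]
    nlinarith [mul_pos hL hL]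
  have h4 : n * (L * (8 * (n * B) + 3 * L) / C + 3 * ∫ g, tl L (K g ^ 2) ∂μ)
      ≤ n * (ε / 4 + 3 * (ε / 12)) := by gcongr
  linarith

lemma IsZC.small (H : IsZC μ τ K)
    (hctrl : ∀ ε > (0 : ℝ), ∃ R > (0 : ℝ), ∀ n : ℕ, 1 ≤ n → ∀ x : Z,
      ENNReal.ofReal (1 - ε) ≤ convPow μ n {g | |τ g x| ≤ R})
    {ε : ℝ} (hε : 0 < ε) :
    ∃ n0 : ℕ, 1 ≤ n0 ∧ ∀ n ≥ n0, ∀ x, vv μ τ n x ≤ ε * n := by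
  obtain ⟨Λ, hΛ, hUI⟩ := H.UI (show 0 < ε / 3 by positivity)
  obtain ⟨R, hR, hc⟩ := hctrl (ε / 3 / Λ) (by positivity)
  refine ⟨⌈R ^ 2 * 3 / ε⌉₊ + 1, by omega, fun n hn x => ?_⟩
  have hn1 : 1 ≤ n := by omega
  have hn' : R ^ 2 * 3 / ε ≤ n := (Nat.le_ceil _).trans (by exact_mod_cast (by omega))
  rw [div_le_iff₀ hε] at hn'
  have hU := hUI n hn1 x
  have hcx := hc n hn1 x
  have hms : MeasurableSet {g | |τ g x| ≤ R} :=
    measurableSet_le (H.meas1 x).abs measurable_const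
  have hp : (convPow μ n).real {g | |τ g x| ≤ R}ᶜ ≤ ε / 3 / Λ := by
    rw [probReal_compl_eq_one_sub hms]
    have : 1 - ε / 3 / Λ ≤ (convPow μ n).real {g | |τ g x| ≤ R} :=
      (ENNReal.ofReal_le_iff_le_toReal (measure_ne_top _ _)).1 hcx
    linarith
  have iT := tl_int (H.sqint x n) (fun _ => sq_nonneg _) (Λ * n)
  have iI : Integrable (fun g => Λ * n * ({g | |τ g x| ≤ R}ᶜ).indicator (fun _ => (1 : ℝ)) g)
      (convPow μ n) := ((integrable_const _).indicator hms.compl).const_mul _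
  have iS : Integrable (fun g => R ^ 2 +
      Λ * n * ({g | |τ g x| ≤ R}ᶜ).indicator (fun _ => (1 : ℝ)) g) (convPow μ n) :=
    (integrable_const _).add iI
  have hpt : ∀ g, τ g x ^ 2 ≤ R ^ 2 +
      Λ * n * ({g | |τ g x| ≤ R}ᶜ).indicator (fun _ => (1 : ℝ)) g + tl (Λ * n) (τ g x ^ 2) := by
    intro g
    have h0 := tl_nonneg (L := Λ * n) (sq_nonneg (τ g x))
    have hΛn : 0 ≤ Λ * n := by positivity
    by_cases h : |τ g x| ≤ R
    · have : τ g x ^ 2 ≤ R ^ 2 := by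
        rw [← sq_abs (τ g x)]; exact pow_le_pow_left₀ (abs_nonneg _) h 2
      have h1 : 0 ≤ ({g | |τ g x| ≤ R}ᶜ).indicator (fun _ => (1 : ℝ)) g :=
        Set.indicator_nonneg (fun _ _ => zero_le_one) _
      have := mul_nonneg hΛn h1
      linarith
    · have e : ({g | |τ g x| ≤ R}ᶜ).indicator (fun _ => (1 : ℝ)) g = 1 :=
        Set.indicator_of_mem (by simpa using h) _
      rw [e]
      unfold tl at *
      split_ifs at * with h2 <;> nlinarith [sq_nonneg R]
  have h1 : vv μ τ n x ≤ _ := integral_mono (H.sqint x n) (iS.add iT) hpt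
  simp only [Pi.add_apply] at h1
  rw [MeasureTheory.integral_add iS iT, MeasureTheory.integral_add (integrable_const _) iI,
    integral_const_mul, integral_indicator_const _ hms.compl] at h1
  simp only [integral_const, probReal_univ, smul_eq_mul, mul_one] at h1
  have h2 : Λ * n * (convPow μ n).real {g | |τ g x| ≤ R}ᶜ ≤ Λ * n * (ε / 3 / Λ) := by gcongr
  have h3 : Λ * n * (ε / 3 / Λ) = ε / 3 * n := by field_simp
  linarith

lemma IsZC.pair (H : IsZC μ τ K) :
    IsZC (Z := Z × Z) μ (fun g p => τ g p.1 - τ g p.2) (fun g => 2 * K g) where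
  act := by
    have h1 : Measurable fun p : G × (Z × Z) => p.1 • p.2.1 :=
      H.act.comp (measurable_fst.prodMk (measurable_fst.comp measurable_snd))
    have h2 : Measurable fun p : G × (Z × Z) => p.1 • p.2.2 :=
      H.act.comp (measurable_fst.prodMk (measurable_snd.comp measurable_snd))
    exact h1.prodMk h2
  meas := by
    have h1 : Measurable fun p : G × (Z × Z) => τ p.1 p.2.1 :=
      H.meas.comp (measurable_fst.prodMk (measurable_fst.comp measurable_snd))
    have h2 : Measurable fun p : G × (Z × Z) => τ p.1 p.2.2 :=
      H.meas.comp (measurable_fst.prodMk (measurable_snd.comp measurable_snd))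
    exact h1.sub h2
  coc := by
    intro g₁ g₂ x
    simp only [H.coc, Prod.smul_fst, Prod.smul_snd]
    ring
  dom := by
    intro g x
    have := abs_sub (τ g x.1) (τ g x.2)
    linarith [H.dom g x.1, H.dom g x.2]
  int2 := by
    have := H.int2.const_mul 4
    refine this.congr (ae_of_all _ fun g => ?_)
    simp only
    ring
  drift := by
    intro x
    have h1 := H.int x.1 1
    have h2 := H.int x.2 1
    rw [convPow_one] at h1 h2
    rw [integral_sub h1 h2, H.drift, H.drift, sub_zero]

lemma IsZC.vv_diff (H : IsZC μ τ K)
    (hctrl : ∀ ε > (0 : ℝ), ∃ R > (0 : ℝ), ∀ n : ℕ, 1 ≤ n → ∀ x y : Z,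
      ENNReal.ofReal (1 - ε) ≤ convPow μ n {g | |τ g x - τ g y| ≤ R})
    {ε : ℝ} (hε : 0 < ε) :
    ∃ n0 : ℕ, 1 ≤ n0 ∧ ∀ n ≥ n0, ∀ x y, vv μ τ n x - vv μ τ n y ≤ ε * n := by
  have hB : 0 ≤ ∫ g, K g ^ 2 ∂μ := integral_nonneg fun _ => sq_nonneg _
  have hle := H.vv_le
  generalize ∫ g, K g ^ 2 ∂μ = B at *
  set η : ℝ := ε / (4 * (B + 1)) with hη
  have hη0 : 0 < η := by positivity
  obtain ⟨n0, hn0, h⟩ := H.pair.small (fun e he => by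
    obtain ⟨R, hR, hh⟩ := hctrl e he
    exact ⟨R, hR, fun n hn x => hh n hn x.1 x.2⟩) (show 0 < η * (ε / 2) by positivity)
  refine ⟨n0, hn0, fun n hn x y => ?_⟩
  have hw := h n hn (x, y)
  have i1 := H.sqint x n
  have i2 := H.sqint y n
  have i3 : Integrable (fun g => (τ g x - τ g y) ^ 2) (convPow μ n) := H.pair.sqint (x, y) n
  have i4 : Integrable (fun g => τ g x ^ 2 + τ g y ^ 2) (convPow μ n) := i1.add i2
  simp only [vv] at hw
  have hpt : ∀ g, τ g x ^ 2 - τ g y ^ 2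
      ≤ η⁻¹ * (τ g x - τ g y) ^ 2 + η * (τ g x ^ 2 + τ g y ^ 2) := by
    intro g
    generalize τ g x = a
    generalize τ g y = b
    have e : η⁻¹ * (a - b) ^ 2 + η * (a ^ 2 + b ^ 2) - (a ^ 2 - b ^ 2)
      = η⁻¹ * ((a - b) - η / 2 * (a + b)) ^ 2 + η * ((a ^ 2 + b ^ 2) - (a + b) ^ 2 / 4) := by
      field_simp
      ring
    have : 0 ≤ η⁻¹ * ((a - b) - η / 2 * (a + b)) ^ 2
        + η * ((a ^ 2 + b ^ 2) - (a + b) ^ 2 / 4) := by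
      have : 0 ≤ (a ^ 2 + b ^ 2) - (a + b) ^ 2 / 4 := by
        nlinarith [sq_nonneg (a - b), sq_nonneg (a + b)]
      positivity
    linarith
  have h1 := integral_mono (i1.sub i2) ((i3.const_mul η⁻¹).add (i4.const_mul η)) hpt
  simp only [Pi.add_apply, Pi.sub_apply] at h1
  rw [integral_sub i1 i2, MeasureTheory.integral_add (i3.const_mul η⁻¹)
    (i4.const_mul η), integral_const_mul, integral_const_mul,
    MeasureTheory.integral_add i1 i2] at h1
  have hx := hle n x
  have hy := hle n y
  simp only [vv] at hx hy ⊢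
  have h2 : η⁻¹ * ∫ g, (τ g x - τ g y) ^ 2 ∂convPow μ n ≤ η⁻¹ * (η * (ε / 2) * n) := by gcongr
  have h3 : η⁻¹ * (η * (ε / 2) * n) = ε / 2 * n := by field_simp
  have h4 : η * (∫ g, τ g x ^ 2 ∂convPow μ n + ∫ g, τ g y ^ 2 ∂convPow μ n)
      ≤ η * (n * B + n * B) := by gcongr
  have h5 : η * (n * B + n * B) ≤ ε / 2 * n := by
    have : ε = η * (4 * (B + 1)) := by rw [hη]; field_simp
    rw [this]
    have : 0 ≤ η * n := by positivity
    nlinarith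
  linarith

lemma IsZC.exists_A [Nonempty Z] (H : IsZC μ τ K)
    (hctrl : ∀ ε > (0 : ℝ), ∃ R > (0 : ℝ), ∀ n : ℕ, 1 ≤ n → ∀ x y : Z,
      ENNReal.ofReal (1 - ε) ≤ convPow μ n {g | |τ g x - τ g y| ≤ R}) :
    ∃ A : ℝ, 0 ≤ A ∧ ∀ ε > 0, ∃ n0 : ℕ, 1 ≤ n0 ∧ ∀ n ≥ n0, ∀ x,
      |vv μ τ n x - n * A| ≤ ε * n := by
  have hle := H.vv_le
  have hbd : ∀ n, BddAbove (Set.range fun x => vv μ τ n x) := fun n =>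
    ⟨_, by rintro _ ⟨x, rfl⟩; exact hle n x⟩
  set u : ℕ → ℝ := fun n => ⨆ x, vv μ τ n x with hu
  have hsub : Subadditive u := by
    intro m n
    refine ciSup_le fun x => ?_
    rw [H.vv_add]
    have h1 : vv μ τ n x ≤ u n := le_ciSup (hbd n) x
    have h2 := integral_le_const (H.vv_int m n x) (fun g => le_ciSup (hbd m) (g • x))
    have h3 : (⨆ x, vv μ τ m x) = u m := rfl
    linarith
  have hu0 : ∀ n, 0 ≤ u n := fun n =>
    (vv_nonneg n (Classical.arbitrary Z)).trans (le_ciSup (hbd n) _)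
  have hbb : BddBelow (Set.range fun n => u n / n) :=
    ⟨0, by rintro _ ⟨n, rfl⟩; have := hu0 n; positivity⟩
  have hlim := hsub.tendsto_lim hbb
  refine ⟨hsub.lim, ge_of_tendsto' hlim fun n => by have := hu0 n; positivity, fun ε hε => ?_⟩
  obtain ⟨n1, hn1, h1⟩ := H.vv_diff hctrl (show 0 < ε / 2 by positivity)
  obtain ⟨n2, h2⟩ := (Metric.tendsto_atTop.1 hlim) (ε / 2) (by positivity)
  refine ⟨max n1 n2, hn1.trans (le_max_left _ _), fun n hn x => ?_⟩
  have hn1' : n1 ≤ n := (le_max_left _ _).trans hn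
  have hn2' : n2 ≤ n := (le_max_right _ _).trans hn
  have hnpos : (0 : ℝ) < n := by exact_mod_cast (by omega : 0 < n)
  have h3 := h2 n hn2'
  rw [Real.dist_eq, abs_lt] at h3
  have e : u n = u n / n * n := by field_simp
  have h4 : u n ≤ vv μ τ n x + ε / 2 * n := ciSup_le fun y => by linarith [h1 n hn1' y x]
  have h5 : vv μ τ n x ≤ u n := le_ciSup (hbd n) x
  rw [abs_le]
  constructor <;> nlinarith

/-- characteristic function -/
def ps (μ : Measure G) (τ : G → Z → ℝ) (n : ℕ) (t : ℝ) (x : Z) : ℂ :=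
  ∫ g, Complex.exp (((t * τ g x : ℝ) : ℂ) * Complex.I) ∂convPow μ n

lemma exp_taylor {κ : ℝ} (hκ : 0 < κ) (hκ1 : κ ≤ 1) (u : ℝ) :
    ‖Complex.exp ((u : ℂ) * Complex.I) - ((1 : ℂ) + (u : ℂ) * Complex.I - ((u ^ 2 / 2 : ℝ) : ℂ))‖
      ≤ κ * u ^ 2 + 4 * tl (κ ^ 2) (u ^ 2) := by
  have hn : ‖(u : ℂ) * Complex.I‖ = |u| := by simp
  by_cases h1 : |u| ≤ 1
  · have hb := Complex.exp_bound (x := (u : ℂ) * Complex.I) (by rw [hn]; exact h1)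
      (n := 3) (by norm_num)
    have e : ∑ m ∈ Finset.range 3, ((u : ℂ) * Complex.I) ^ m / (m.factorial : ℂ)
        = (1 : ℂ) + (u : ℂ) * Complex.I - ((u ^ 2 / 2 : ℝ) : ℂ) := by
      simp [Finset.sum_range_succ, mul_pow, Nat.factorial]
      ring
    rw [e, hn] at hb
    refine hb.trans ?_
    have h3 : |u| ^ 3 * ((Nat.succ 3 : ℝ) * ((Nat.factorial 3 : ℝ) * (3 : ℕ))⁻¹) ≤ |u| * u ^ 2 := by
      have e3 : |u| * u ^ 2 = |u| ^ 3 := by rw [← sq_abs u]; ring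
      have : 0 ≤ |u| ^ 3 := by positivity
      rw [e3]
      norm_num [Nat.factorial]
      linarith
    refine h3.trans ?_
    have h0 := tl_nonneg (L := κ ^ 2) (sq_nonneg u)
    by_cases h2 : |u| ≤ κ
    · nlinarith [mul_le_mul_of_nonneg_right h2 (sq_nonneg u)]
    · have h3 : κ ^ 2 < u ^ 2 := by
        rw [← sq_abs u]; exact pow_lt_pow_left₀ (not_le.1 h2) hκ.le (by norm_num)
      simp only [tl, h3, if_true]
      nlinarith [mul_le_mul_of_nonneg_right h1 (sq_nonneg u), mul_nonneg hκ.le (sq_nonneg u)]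
  · push Not at h1
    have hu2 : 1 < u ^ 2 := by rw [← sq_abs u]; nlinarith
    have h3 : κ ^ 2 < u ^ 2 := by nlinarith
    simp only [tl, h3, if_true]
    have a1 : ‖Complex.exp ((u : ℂ) * Complex.I)‖ = 1 := Complex.norm_exp_ofReal_mul_I u
    have a2 : ‖((u ^ 2 / 2 : ℝ) : ℂ)‖ = u ^ 2 / 2 := by
      rw [Complex.norm_real, Real.norm_eq_abs, abs_of_nonneg (by positivity)]
    have a3 : ‖(1 : ℂ) + (u : ℂ) * Complex.I - ((u ^ 2 / 2 : ℝ) : ℂ)‖ ≤ 1 + |u| + u ^ 2 / 2 := by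
      refine (norm_sub_le _ _).trans ?_
      rw [a2]
      have := norm_add_le (1 : ℂ) ((u : ℂ) * Complex.I)
      rw [hn, norm_one] at this
      linarith
    have a4 := norm_sub_le (Complex.exp ((u : ℂ) * Complex.I))
      ((1 : ℂ) + (u : ℂ) * Complex.I - ((u ^ 2 / 2 : ℝ) : ℂ))
    have a5 : |u| ≤ u ^ 2 := by rw [← sq_abs u]; nlinarith
    nlinarith [mul_nonneg hκ.le (sq_nonneg u)]

lemma IsZC.exp_int (H : IsZC μ τ K) (n : ℕ) (t : ℝ) (x : Z) :
    Integrable (fun g => Complex.exp (((t * τ g x : ℝ) : ℂ) * Complex.I)) (convPow μ n) := by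
  refine (integrable_const (1 : ℝ)).mono' ?_ (ae_of_all _ fun g => ?_)
  · have := H.meas1 x
    exact (by fun_prop : Measurable fun g =>
      Complex.exp (((t * τ g x : ℝ) : ℂ) * Complex.I)).aestronglyMeasurable
  · rw [Complex.norm_exp_ofReal_mul_I]

lemma IsZC.ps_approx (H : IsZC μ τ K) {κ : ℝ} (hκ : 0 < κ) (hκ1 : κ ≤ 1) (n : ℕ) (t : ℝ) (x : Z) :
    ‖ps μ τ n t x - ((1 - t ^ 2 / 2 * vv μ τ n x : ℝ) : ℂ)‖
      ≤ κ * (t ^ 2 * vv μ τ n x) + 4 * ∫ g, tl (κ ^ 2) (t ^ 2 * τ g x ^ 2) ∂convPow μ n := by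
  have i1 := H.exp_int n t x
  have i2 : Integrable (fun g => (((t * τ g x : ℝ) : ℂ) * Complex.I)) (convPow μ n) :=
    (((H.int x n).const_mul t).ofReal).mul_const _
  have i3 : Integrable (fun g => (((t * τ g x) ^ 2 / 2 : ℝ) : ℂ)) (convPow μ n) := by
    have : Integrable (fun g => ((t * τ g x) ^ 2 / 2 : ℝ)) (convPow μ n) := by
      refine ((H.sqint x n).const_mul (t ^ 2 / 2)).congr (ae_of_all _ fun g => ?_)
      simp only
      ring
    exact this.ofReal
  have i4 : Integrable (fun g => (1 : ℂ) + ((t * τ g x : ℝ) : ℂ) * Complex.I) (convPow μ n) :=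
    (integrable_const _).add i2
  have i5 : Integrable (fun g => (1 : ℂ) + ((t * τ g x : ℝ) : ℂ) * Complex.I
    - (((t * τ g x) ^ 2 / 2 : ℝ) : ℂ)) (convPow μ n) := i4.sub i3
  have i6 : Integrable (fun g => t ^ 2 * τ g x ^ 2) (convPow μ n) := (H.sqint x n).const_mul _
  have i7 := tl_int i6 (fun g => by positivity) (κ ^ 2)
  have e2 : ∫ g, (((t * τ g x : ℝ) : ℂ) * Complex.I) ∂convPow μ n = 0 := by
    rw [integral_mul_const, integral_complex_ofReal, integral_const_mul, H.mean]
    simp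
  have e3 : ∫ g, (((t * τ g x) ^ 2 / 2 : ℝ) : ℂ) ∂convPow μ n
      = ((t ^ 2 / 2 * vv μ τ n x : ℝ) : ℂ) := by
    rw [integral_complex_ofReal, vv, ← integral_const_mul]
    congr 2
    ext g
    ring
  have e : ps μ τ n t x - ((1 - t ^ 2 / 2 * vv μ τ n x : ℝ) : ℂ)
      = ∫ g, (Complex.exp (((t * τ g x : ℝ) : ℂ) * Complex.I) -
        ((1 : ℂ) + ((t * τ g x : ℝ) : ℂ) * Complex.I - (((t * τ g x) ^ 2 / 2 : ℝ) : ℂ)))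
          ∂convPow μ n := by
    rw [integral_sub i1 i5, integral_sub i4 i3, MeasureTheory.integral_add (integrable_const _) i2,
      e2, e3, ps]
    simp
  rw [e]
  refine (norm_integral_le_of_norm_le ((i6.const_mul κ).add (i7.const_mul 4))
    (ae_of_all _ fun g => ?_)).trans_eq ?_
  · have := exp_taylor hκ hκ1 (t * τ g x)
    simp only [Pi.add_apply]
    rwa [mul_pow] at this ⊢
  · simp only [Pi.add_apply]
    rw [MeasureTheory.integral_add (i6.const_mul κ) (i7.const_mul 4), integral_const_mul,
      integral_const_mul, integral_const_mul, vv]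

lemma IsZC.ps_crude (H : IsZC μ τ K) {A : ℝ} (hA : 0 ≤ A) :
    ∃ C : ℝ, 0 ≤ C ∧ ∀ t x,
      ‖ps μ τ 1 t x - ((Real.exp (-(t ^ 2 * (1 : ℕ) * A / 2)) : ℝ) : ℂ)‖ ≤ C * t ^ 2 := by
  have hB : 0 ≤ ∫ g, K g ^ 2 ∂μ := integral_nonneg fun _ => sq_nonneg _
  have hle := H.vv_one
  generalize ∫ g, K g ^ 2 ∂μ = B at *
  refine ⟨6 * B + A, by positivity, fun t x => ?_⟩
  have h1 := H.ps_approx one_pos le_rfl 1 t x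
  have i6 : Integrable (fun g => t ^ 2 * τ g x ^ 2) (convPow μ 1) := (H.sqint x 1).const_mul _
  have h2 : ∫ g, tl (1 ^ 2) (t ^ 2 * τ g x ^ 2) ∂convPow μ 1 ≤ t ^ 2 * vv μ τ 1 x := by
    rw [vv, ← integral_const_mul]
    exact integral_mono (tl_int i6 (fun g => by positivity) _) i6
      fun g => tl_le (by positivity)
  have h3 := hle x
  have h0 := vv_nonneg (μ := μ) (τ := τ) 1 x
  have h4 : ‖((1 - t ^ 2 / 2 * vv μ τ 1 x : ℝ) : ℂ)
      - ((Real.exp (-(t ^ 2 * (1 : ℕ) * A / 2)) : ℝ) : ℂ)‖ ≤ t ^ 2 / 2 * B + t ^ 2 * A / 2 := by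
    rw [← Complex.ofReal_sub, Complex.norm_real, Real.norm_eq_abs]
    have a1 := Real.add_one_le_exp (-(t ^ 2 * (1 : ℕ) * A / 2))
    have a2 : Real.exp (-(t ^ 2 * (1 : ℕ) * A / 2)) ≤ 1 := by
      rw [Real.exp_le_one_iff, neg_nonpos]; positivity
    have a3 : t ^ 2 / 2 * vv μ τ 1 x ≤ t ^ 2 / 2 * B := by gcongr
    have a4 : 0 ≤ t ^ 2 / 2 * vv μ τ 1 x := by positivity
    have a5 : 0 ≤ t ^ 2 * A / 2 := by positivity
    push_cast at *
    rw [mul_one] at *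
    rw [abs_le]; constructor <;> linarith
  have h5 := norm_sub_le_norm_sub_add_norm_sub (ps μ τ 1 t x)
    ((1 - t ^ 2 / 2 * vv μ τ 1 x : ℝ) : ℂ) ((Real.exp (-(t ^ 2 * (1 : ℕ) * A / 2)) : ℝ) : ℂ)
  have h6 : t ^ 2 * vv μ τ 1 x ≤ t ^ 2 * B := by gcongr
  have h7 : 0 ≤ t ^ 2 * B := by positivity
  have h8 : 0 ≤ t ^ 2 * A := by positivity
  refine h5.trans ((add_le_add h1 h4).trans ?_)
  clear h5 h1 h4
  generalize ∫ g, tl (1 ^ 2) (t ^ 2 * τ g x ^ 2) ∂convPow μ 1 = J at *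
  generalize vv μ τ 1 x = v at *
  nlinarith

lemma IsZC.ps_good (H : IsZC μ τ K) {A : ℝ} (hA : 0 ≤ A)
    (hAc : ∀ ε > 0, ∃ n0 : ℕ, 1 ≤ n0 ∧ ∀ n ≥ n0, ∀ x, |vv μ τ n x - n * A| ≤ ε * n)
    {ε : ℝ} (hε : 0 < ε) :
    ∃ m : ℕ, 1 ≤ m ∧ ∃ t0 > (0 : ℝ), ∀ t, t ^ 2 ≤ t0 → ∀ x,
      ‖ps μ τ m t x - ((Real.exp (-(t ^ 2 * m * A / 2)) : ℝ) : ℂ)‖ ≤ ε * t ^ 2 * m := by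
  have hB : 0 ≤ ∫ g, K g ^ 2 ∂μ := integral_nonneg fun _ => sq_nonneg _
  have hle := H.vv_le
  generalize ∫ g, K g ^ 2 ∂μ = B at *
  obtain ⟨m, hm, hmA⟩ := hAc (ε / 2) (by positivity)
  obtain ⟨Λ, hΛ, hUI⟩ := H.UI (show 0 < ε / 16 by positivity)
  set κ : ℝ := min 1 (ε / (4 * (B + 1))) with hκdef
  have hκ : 0 < κ := by positivity
  have hκ1 : κ ≤ 1 := min_le_left _ _
  have hκB : κ * B ≤ ε / 4 := by
    have : κ * (B + 1) ≤ ε / (4 * (B + 1)) * (B + 1) := by gcongr; exact min_le_right _ _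
    have e : ε / (4 * (B + 1)) * (B + 1) = ε / 4 := by field_simp
    nlinarith
  have hm0 : (0 : ℝ) < m := by exact_mod_cast hm
  refine ⟨m, hm, min (κ ^ 2 / (Λ * m)) (min (1 / (m * A + 1)) (ε / (m * A ^ 2 + 1))),
    by positivity, fun t ht x => ?_⟩
  have ht1 := ht.trans (min_le_left _ _)
  have ht2 := (ht.trans (min_le_right _ _)).trans (min_le_left _ _)
  have ht3 := (ht.trans (min_le_right _ _)).trans (min_le_right _ _)
  rw [le_div_iff₀ (by positivity)] at ht1 ht2 ht3
  have htt := sq_nonneg t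
  have h1 := H.ps_approx hκ hκ1 m t x
  have i6 : Integrable (fun g => t ^ 2 * τ g x ^ 2) (convPow μ m) := (H.sqint x m).const_mul _
  have h2 : ∫ g, tl (κ ^ 2) (t ^ 2 * τ g x ^ 2) ∂convPow μ m ≤ t ^ 2 * (ε / 16 * m) := by
    refine le_trans ?_ (mul_le_mul_of_nonneg_left (hUI m hm x) htt)
    rw [← integral_const_mul]
    refine integral_mono (tl_int i6 (fun g => by positivity) _)
      ((tl_int (H.sqint x m) (fun _ => sq_nonneg _) _).const_mul _) fun g => ?_
    by_cases hc : κ ^ 2 < t ^ 2 * τ g x ^ 2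
    · have : Λ * m < τ g x ^ 2 := by
        by_contra hcon
        push Not at hcon
        have := mul_le_mul_of_nonneg_left hcon htt
        linarith
      simp [tl, hc, this]
    · have : 0 ≤ t ^ 2 * tl (Λ * m) (τ g x ^ 2) := mul_nonneg htt (tl_nonneg (sq_nonneg _))
      simpa [tl, hc] using this
  have h3 : κ * (t ^ 2 * vv μ τ m x) ≤ ε / 4 * t ^ 2 * m := by
    have : κ * (t ^ 2 * vv μ τ m x) ≤ κ * (t ^ 2 * (m * B)) := by gcongr; exact hle m x
    have : (κ * B) * (t ^ 2 * m) ≤ ε / 4 * (t ^ 2 * m) := by gcongr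
    nlinarith
  set w : ℝ := t ^ 2 * m * A / 2 with hw
  have hw0 : 0 ≤ w := by positivity
  have hw1 : w ≤ 1 := by rw [hw]; nlinarith
  have h4 := Real.abs_exp_sub_one_sub_id_le (x := -w) (by rw [abs_neg, abs_of_nonneg hw0]; exact hw1)
  have h5 : (-w) ^ 2 ≤ ε / 4 * t ^ 2 * m := by
    have e : (-w) ^ 2 = (t ^ 2 * (m * A ^ 2)) * (t ^ 2 * m) / 4 := by rw [hw]; ring
    have : (t ^ 2 * (m * A ^ 2)) * (t ^ 2 * m) ≤ ε * (t ^ 2 * m) := by gcongr; linarith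
    rw [e]; linarith
  have h6 : ‖((1 - t ^ 2 / 2 * vv μ τ m x : ℝ) : ℂ) - ((Real.exp (-w) : ℝ) : ℂ)‖
      ≤ ε / 2 * t ^ 2 * m := by
    rw [← Complex.ofReal_sub, Complex.norm_real, Real.norm_eq_abs]
    have a1 := abs_le.1 (hmA m le_rfl x)
    have a2 := mul_le_mul_of_nonneg_left a1.1 (show 0 ≤ t ^ 2 / 2 by positivity)
    have a3 := mul_le_mul_of_nonneg_left a1.2 (show 0 ≤ t ^ 2 / 2 by positivity)
    have a4 := abs_le.1 (h4.trans h5)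
    have e1 : t ^ 2 / 2 * (vv μ τ m x - m * A) = t ^ 2 / 2 * vv μ τ m x - w := by rw [hw]; ring
    rw [e1] at a2 a3
    rw [abs_le]; constructor <;> linarith [a4.1, a4.2]
  have h7 := norm_sub_le_norm_sub_add_norm_sub (ps μ τ m t x)
    ((1 - t ^ 2 / 2 * vv μ τ m x : ℝ) : ℂ) ((Real.exp (-w) : ℝ) : ℂ)
  linarith

lemma IsZC.ps_add (H : IsZC μ τ K) {A : ℝ} (hA : 0 ≤ A) {t a b : ℝ} {m n : ℕ}
    (hm : ∀ x, ‖ps μ τ m t x - ((Real.exp (-(t ^ 2 * m * A / 2)) : ℝ) : ℂ)‖ ≤ a)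
    (hn : ∀ x, ‖ps μ τ n t x - ((Real.exp (-(t ^ 2 * n * A / 2)) : ℝ) : ℂ)‖ ≤ b) (x : Z) :
    ‖ps μ τ (m + n) t x - ((Real.exp (-(t ^ 2 * (m + n : ℕ) * A / 2)) : ℝ) : ℂ)‖ ≤ a + b := by
  have inner : ∀ h : G, ∫ g, Complex.exp (((t * τ (g * h) x : ℝ) : ℂ) * Complex.I) ∂convPow μ m
      = Complex.exp (((t * τ h x : ℝ) : ℂ) * Complex.I) * ps μ τ m t (h • x) := by
    intro h
    rw [ps, ← integral_const_mul]
    congr 1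
    ext g
    rw [← Complex.exp_add, H.coc]
    congr 1
    push_cast
    ring
  have hI := H.exp_int (m + n) t x
  have j1 := (integrable_add hI).integral_prod_right
  have e1 : ps μ τ (m + n) t x = ∫ h, Complex.exp (((t * τ h x : ℝ) : ℂ) * Complex.I)
      * ps μ τ m t (h • x) ∂convPow μ n := by
    rw [ps, integral_add hI]
    simp only [inner]
  simp only [inner] at j1
  have ee : Real.exp (-(t ^ 2 * (m + n : ℕ) * A / 2))
      = Real.exp (-(t ^ 2 * m * A / 2)) * Real.exp (-(t ^ 2 * n * A / 2)) := by
    rw [← Real.exp_add]; congr 1; push_cast; ring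
  have hE1 : Real.exp (-(t ^ 2 * m * A / 2)) ≤ 1 := by
    rw [Real.exp_le_one_iff, neg_nonpos]; positivity
  have hE0 := Real.exp_pos (-(t ^ 2 * m * A / 2))
  rw [ee]
  generalize Real.exp (-(t ^ 2 * m * A / 2)) = Em at *
  have hnx := hn x
  generalize Real.exp (-(t ^ 2 * n * A / 2)) = En at *
  have j2 := (H.exp_int n t x).mul_const (Em : ℂ)
  have e2 : ps μ τ (m + n) t x - ((Em * En : ℝ) : ℂ)
      = (∫ h, (Complex.exp (((t * τ h x : ℝ) : ℂ) * Complex.I) * ps μ τ m t (h • x)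
        - Complex.exp (((t * τ h x : ℝ) : ℂ) * Complex.I) * (Em : ℂ)) ∂convPow μ n)
        + (Em : ℂ) * (ps μ τ n t x - (En : ℂ)) := by
    rw [integral_sub j1 j2, integral_mul_const, e1]
    unfold ps
    push_cast
    ring
  rw [e2]
  refine (norm_add_le _ _).trans (add_le_add ?_ ?_)
  · refine (norm_integral_le_of_norm_le (integrable_const a) (ae_of_all _ fun h => ?_)).trans_eq
      (by simp)
    rw [← mul_sub, norm_mul, Complex.norm_exp_ofReal_mul_I, one_mul]
    exact hm _
  · rw [norm_mul, Complex.norm_real, Real.norm_eq_abs, abs_of_pos hE0]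
    exact (mul_le_of_le_one_left (norm_nonneg _) hE1).trans hnx

lemma IsZC.ps_mul (H : IsZC μ τ K) {A : ℝ} (hA : 0 ≤ A) {t a : ℝ} {m : ℕ}
    (hm : ∀ x, ‖ps μ τ m t x - ((Real.exp (-(t ^ 2 * m * A / 2)) : ℝ) : ℂ)‖ ≤ a) (k : ℕ) :
    ∀ x, ‖ps μ τ (k * m) t x - ((Real.exp (-(t ^ 2 * (k * m : ℕ) * A / 2)) : ℝ) : ℂ)‖ ≤ k * a := by
  induction k with
  | zero =>
    intro x
    have h1 : ps μ τ 0 t x = 1 := by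
      have h2 := H.coc 1 1 x
      simp at h2
      unfold ps convPow
      have := H.meas1 x
      rw [integral_dirac' _ _ (by
        exact (by fun_prop : Measurable fun g =>
          Complex.exp (((t * τ g x : ℝ) : ℂ) * Complex.I)).stronglyMeasurable)]
      simp [h2]
    rw [Nat.zero_mul, h1]
    simp
  | succ k ih =>
    intro x
    rw [Nat.succ_mul]
    refine (H.ps_add hA ih hm x).trans_eq ?_
    push_cast
    ring

lemma IsZC.ps_lim (H : IsZC μ τ K) {A : ℝ} (hA : 0 ≤ A)
    (hAc : ∀ ε > 0, ∃ n0 : ℕ, 1 ≤ n0 ∧ ∀ n ≥ n0, ∀ x, |vv μ τ n x - n * A| ≤ ε * n)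
    (s : ℝ) (x : Z) :
    Tendsto (fun n : ℕ => ps μ τ n (s * (Real.sqrt n)⁻¹) x) atTop
      (𝓝 ((Real.exp (-(s ^ 2 * A / 2)) : ℝ) : ℂ)) := by
  obtain ⟨C, hC, hcr⟩ := H.ps_crude hA
  rw [Metric.tendsto_atTop]
  intro ε hε
  obtain ⟨m, hm, t0, ht0, hg⟩ := H.ps_good hA hAc
    (show 0 < ε / (2 * (s ^ 2 + 1)) by positivity)
  have hm0 : (0 : ℝ) < m := by exact_mod_cast hm
  refine ⟨max (⌈s ^ 2 / t0⌉₊ + 1) (⌈m * C * s ^ 2 / (ε / 4)⌉₊ + 1), fun n hn => ?_⟩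
  have hna : ⌈s ^ 2 / t0⌉₊ + 1 ≤ n := (le_max_left _ _).trans hn
  have hnb : ⌈m * C * s ^ 2 / (ε / 4)⌉₊ + 1 ≤ n := (le_max_right _ _).trans hn
  have hn0 : (0 : ℝ) < n := by exact_mod_cast (by omega : 0 < n)
  have hna' : s ^ 2 / t0 ≤ n := (Nat.le_ceil _).trans (by exact_mod_cast (by omega))
  have hnb' : m * C * s ^ 2 / (ε / 4) ≤ n := (Nat.le_ceil _).trans (by exact_mod_cast (by omega))
  rw [div_le_iff₀ (by positivity)] at hna' hnb'
  set t : ℝ := s * (Real.sqrt n)⁻¹ with ht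
  have ht2 : t ^ 2 * n = s ^ 2 := by
    rw [ht, mul_pow, inv_pow, Real.sq_sqrt hn0.le]; field_simp
  have ht2' : t ^ 2 ≤ t0 := by
    have : t ^ 2 * n ≤ t0 * n := by linarith
    exact le_of_mul_le_mul_right this hn0
  have htt := sq_nonneg t
  have hb := H.ps_add hA (H.ps_mul hA (hg t ht2') (n / m))
    (H.ps_mul hA (hcr t) (n % m)) x
  rw [Nat.mul_one, Nat.div_add_mod' n m, ht2] at hb
  rw [dist_eq_norm]
  refine hb.trans_lt ?_
  have hk : ((n / m : ℕ) : ℝ) * m ≤ n := by exact_mod_cast Nat.div_mul_le_self n m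
  have hr : ((n % m : ℕ) : ℝ) ≤ m := by exact_mod_cast (Nat.mod_lt n hm).le
  have h1 : ((n / m : ℕ) : ℝ) * (ε / (2 * (s ^ 2 + 1)) * t ^ 2 * m) ≤ ε / 2 := by
    have e : ((n / m : ℕ) : ℝ) * (ε / (2 * (s ^ 2 + 1)) * t ^ 2 * m)
      = ε / (2 * (s ^ 2 + 1)) * (t ^ 2 * (((n / m : ℕ) : ℝ) * m)) := by ring
    have h2 : t ^ 2 * (((n / m : ℕ) : ℝ) * m) ≤ s ^ 2 + 1 := by
      have := mul_le_mul_of_nonneg_left hk htt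
      linarith
    rw [e]
    calc _ ≤ ε / (2 * (s ^ 2 + 1)) * (s ^ 2 + 1) := by gcongr
      _ = ε / 2 := by field_simp
  have h2 : ((n % m : ℕ) : ℝ) * (C * t ^ 2) ≤ ε / 4 := by
    have h3 : ((n % m : ℕ) : ℝ) * (C * t ^ 2) ≤ m * (C * t ^ 2) := by gcongr
    have h4 : m * (C * t ^ 2) * n ≤ ε / 4 * n := by
      have : m * (C * t ^ 2) * n = m * C * s ^ 2 := by rw [← ht2]; ring
      linarith
    exact h3.trans (le_of_mul_le_mul_right h4 hn0)
  linarith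

end coc
end CLTAux

/-- central limit theorem at some good basepoint `x₀`. -/
theorem clt_at_good_point
    {G : Type*} [Group G] [MeasurableSpace G] [MeasurableMul₂ G]
    {X : Type*} [MetricSpace X] [CompactSpace X] [MeasurableSpace X] [BorelSpace X]
    [MulAction G X] (hact : Measurable fun p : G × X => p.1 • p.2)
    (σ : G → X → ℝ)
    (hσmeas : Measurable fun p : G × X => σ p.1 p.2)
    (hcoc : ∀ g₁ g₂ : G, ∀ x : X, σ (g₂ * g₁) x = σ g₂ (g₁ • x) + σ g₁ x)
    (N : G → ℝ) (hN0 : ∀ g, 0 ≤ N g) (hNsub : ∀ g h : G, N (g * h) ≤ N g + N h)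
    (hNσ : ∀ g x, |σ g x| ≤ N g)
    (μ : Measure G) [IsProbabilityMeasure μ]
    (hmom1 : Integrable N μ)
    (hdrift : ∀ x, ∫ g, σ g x ∂μ = 0)
    (hmom2 : Integrable (fun g => N g ^ 2) μ)
    (hcont : ∀ g, Continuous (σ g))
    (hXctrl : ∀ ε > (0 : ℝ), ∃ R > (0 : ℝ), ∀ n : ℕ, 1 ≤ n → ∀ x y : X,
      ENNReal.ofReal (1 - ε) ≤ convPow μ n {g | |σ g x - σ g y| ≤ R})
    [Nonempty X] :
    ∃ x₀ : X, ∃ A : NNReal,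
      Tendsto (fun n : ℕ => (n : ℝ)⁻¹ * ∫ g, (σ g x₀) ^ 2 ∂convPow μ n)
        atTop (𝓝 (A : ℝ)) ∧
      ∀ f : BoundedContinuousFunction ℝ ℝ,
        Tendsto (fun n : ℕ => ∫ g, f ((Real.sqrt n)⁻¹ * σ g x₀) ∂convPow μ n)
          atTop (𝓝 (∫ y, f y ∂ProbabilityTheory.gaussianReal 0 A)) := by
  have H : CLTAux.IsZC μ σ N := ⟨hact, hσmeas, hcoc, hNσ, hmom2, hdrift⟩
  obtain ⟨A, hA, hAc⟩ := H.exists_A hXctrl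
  obtain ⟨x⟩ := ‹Nonempty X›
  lift A to NNReal using hA
  refine ⟨x, A, ?_, ?_⟩
  · rw [Metric.tendsto_atTop]
    intro ε hε
    obtain ⟨n0, hn0, h⟩ := hAc (ε / 2) (by positivity)
    refine ⟨n0, fun n hn => ?_⟩
    have h1 := h n hn x
    have hnp : (0 : ℝ) < n := by exact_mod_cast (by omega : 0 < n)
    rw [Real.dist_eq]
    have e : (n : ℝ)⁻¹ * ∫ g, (σ g x) ^ 2 ∂convPow μ n - A
        = (n : ℝ)⁻¹ * (CLTAux.vv μ σ n x - n * A) := by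
      unfold CLTAux.vv
      field_simp
    change |(n : ℝ)⁻¹ * ∫ g, (σ g x) ^ 2 ∂convPow μ n - A| < ε
    rw [e, abs_mul, abs_of_pos (inv_pos.2 hnp)]
    calc _ ≤ (n : ℝ)⁻¹ * (ε / 2 * n) := by gcongr
      _ = ε / 2 := by field_simp
      _ < ε := by linarith
  · intro f
    have hm : ∀ n : ℕ, Measurable fun g => (Real.sqrt n)⁻¹ * σ g x :=
      fun n => (H.meas1 x).const_mul _
    let P : ℕ → ProbabilityMeasure ℝ := fun n =>
      ⟨(convPow μ n).map (fun g => (Real.sqrt n)⁻¹ * σ g x),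
        Measure.isProbabilityMeasure_map (hm n).aemeasurable⟩
    let P0 : ProbabilityMeasure ℝ := ⟨ProbabilityTheory.gaussianReal 0 A, inferInstance⟩
    have hP : Tendsto P atTop (𝓝 P0) := by
      rw [ProbabilityMeasure.tendsto_iff_tendsto_charFun]
      intro s
      have e0 : charFun (P0 : Measure ℝ) s = ((Real.exp (-(s ^ 2 * A / 2)) : ℝ) : ℂ) := by
        change charFun (ProbabilityTheory.gaussianReal 0 A) s = _
        rw [ProbabilityTheory.charFun_gaussianReal]
        push_cast
        congr 1
        ring
      rw [e0]
      refine (H.ps_lim A.coe_nonneg hAc s x).congr fun n => ?_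
      change _ = charFun ((convPow μ n).map (fun g => (Real.sqrt n)⁻¹ * σ g x)) s
      rw [charFun_apply_real, integral_map (hm n).aemeasurable (by fun_prop)]
      unfold CLTAux.ps
      congr 1
      ext g
      push_cast
      ring_nf
    rw [ProbabilityMeasure.tendsto_iff_forall_integral_tendsto] at hP
    refine (hP f).congr fun n => ?_
    change ∫ y, f y ∂((convPow μ n).map (fun g => (Real.sqrt n)⁻¹ * σ g x)) = _
    rw [integral_map (hm n).aemeasurable f.continuous.aestronglyMeasurable]
end
end

section
/- Assume d = 1 and that μ has finite second moment. Fix x ∈ X and α > 0, and define the truncated recentered sums S_n(b,x) = Σ_{j=3}^{n} X^{(j)}(b_j, b_{j−1}⋯b_1·x). Then for β-almost every b ∈ B, |σ(b_n⋯b_1, x) − S_n(b,x)| = o(a_n) as n → ∞, where a_n = √(2 n log log n). -/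
open MeasureTheory Filter Topology
open scoped ENNReal NNReal

noncomputable section

/-- The truncated increment X₁⁽ʲ⁾(g, y) = σ(g, y)·1_{|g| ≤ α √(j / log log j)}. -/
def truncInc {G X : Type*} (σ : G → X → ℝ) (N : G → ℝ) (α : ℝ) (j : ℕ)
    (g : G) (y : X) : ℝ :=
  if N g ≤ α * Real.sqrt (j / Real.log (Real.log j)) then σ g y else 0

/-- The recentered truncated increment X⁽ʲ⁾(g, y) = X₁⁽ʲ⁾(g, y) − ∫ X₁⁽ʲ⁾(·, y) dμ. -/
def truncIncC {G X : Type*} [MeasurableSpace G] (σ : G → X → ℝ) (N : G → ℝ)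
    (μ : Measure G) (α : ℝ) (j : ℕ) (g : G) (y : X) : ℝ :=
  truncInc σ N α j g y - ∫ g2, truncInc σ N α j g2 y ∂μ

/-- The truncated recentered sum S_n(b, x) = ∑_{j=3}^n X⁽ʲ⁾(b_j, b_{j-1} ⋯ b_1 · x). -/
def truncSum {G X : Type*} [Monoid G] [MulAction G X] [MeasurableSpace G]
    (σ : G → X → ℝ) (N : G → ℝ) (μ : Measure G) (α : ℝ) (x : X)
    (n : ℕ) (b : ℕ → G) : ℝ :=
  ∑ j ∈ Finset.Icc 3 n, truncIncC σ N μ α j (b (j - 1)) (prodRev b (j - 1) • x)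

/-- The normalisation a_n = √(2 n log log n). -/
def lilNorm (n : ℕ) : ℝ := Real.sqrt (2 * n * Real.log (Real.log n))


def LL (n : ℕ) : ℝ := Real.log (Real.log n)

lemma log_gt_one {n : ℕ} (hn : 3 ≤ n) : 1 < Real.log n := by
  have h3 : (3:ℝ) ≤ n := by exact_mod_cast hn
  rw [Real.lt_log_iff_exp_lt (by linarith)]
  have := Real.exp_one_lt_d9
  linarith

lemma LL_pos {n : ℕ} (hn : 3 ≤ n) : 0 < LL n := Real.log_pos (log_gt_one hn)

lemma LL_mono {m n : ℕ} (hm : 3 ≤ m) (h : m ≤ n) : LL m ≤ LL n := by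
  have h1 := log_gt_one hm
  have h3 : (3:ℝ) ≤ m := by exact_mod_cast hm
  have h4 : (m:ℝ) ≤ n := by exact_mod_cast h
  unfold LL
  apply Real.log_le_log (by linarith)
  apply Real.log_le_log (by linarith) h4

lemma lilNorm_pos {n : ℕ} (hn : 3 ≤ n) : 0 < lilNorm n := by
  have := LL_pos hn
  have h3 : (3:ℝ) ≤ n := by exact_mod_cast hn
  unfold lilNorm
  apply Real.sqrt_pos.2
  unfold LL at this
  positivity

lemma lilNorm_mono {m n : ℕ} (hm : 3 ≤ m) (h : m ≤ n) : lilNorm m ≤ lilNorm n := by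
  have h1 := LL_pos hm
  have h2 := LL_mono hm h
  have h4 : (m:ℝ) ≤ n := by exact_mod_cast h
  unfold lilNorm
  unfold LL at h1 h2
  apply Real.sqrt_le_sqrt
  gcongr

lemma tendsto_LL : Tendsto LL atTop atTop :=
  Real.tendsto_log_atTop.comp (Real.tendsto_log_atTop.comp tendsto_natCast_atTop_atTop)

lemma tendsto_lilNorm : Tendsto lilNorm atTop atTop := by
  unfold lilNorm
  apply Real.tendsto_sqrt_atTop.comp
  apply Tendsto.atTop_mul_atTop₀ _ tendsto_LL
  exact Tendsto.const_mul_atTop (by norm_num) tendsto_natCast_atTop_atTop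

def wgt (j : ℕ) : ℝ := (lilNorm (max j 3))⁻¹

lemma wgt_pos (j : ℕ) : 0 < wgt j := inv_pos.2 (lilNorm_pos (le_max_right _ _))

def ff (n : ℕ) : ℝ := Real.sqrt (n / LL n)

lemma ff_step : ∀ᶠ n : ℕ in atTop, wgt (n+1) ≤ 4 * (ff (n+1) - ff n) := by
  filter_upwards [eventually_ge_atTop 3, tendsto_LL.eventually_ge_atTop 2] with n hn hL
  have h1 := log_gt_one hn
  have hn3 : (3:ℝ) ≤ n := by exact_mod_cast hn
  have hM := LL_mono hn (Nat.le_succ n)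
  have hd : n * (LL (n+1) - LL n) ≤ 1 := by
    have e1 : LL (n+1) - LL n ≤ Real.log ((n+1:ℕ):ℝ) / Real.log n - 1 := by
      have h2 := log_gt_one (show 3 ≤ n+1 by omega)
      unfold LL
      rw [← Real.log_div (by linarith) (by linarith)]
      apply Real.log_le_sub_one_of_pos
      apply div_pos <;> linarith
    have e2 : Real.log ((n+1:ℕ):ℝ) - Real.log n ≤ 1 / n := by
      rw [← Real.log_div (by positivity) (by positivity)]
      refine (Real.log_le_sub_one_of_pos (by positivity)).trans ?_
      push_cast
      apply le_of_eq
      field_simp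
      ring
    have e3 : Real.log ((n+1:ℕ):ℝ) / Real.log n - 1 ≤ 1 / n := by
      have : Real.log ((n+1:ℕ):ℝ) / Real.log n - 1 = (Real.log ((n+1:ℕ):ℝ) - Real.log n) / Real.log n := by
        field_simp
      rw [this]
      have hp : (0:ℝ) < 1 / n := by positivity
      rw [div_le_iff₀ (by linarith)]
      nlinarith
    calc n * (LL (n+1) - LL n) ≤ n * (1 / n) := by gcongr; linarith
      _ = 1 := by field_simp
  have hLp : 0 < LL n := by linarith
  have hMp : 0 < LL (n+1) := LL_pos (by omega)
  set L := LL n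
  set M := LL (n+1)
  set a := ff n with ha
  set b := ff (n+1) with hb
  have ha2 : a ^ 2 = n / L := Real.sq_sqrt (by positivity)
  have hb2 : b ^ 2 = (n+1) / M := by
    rw [hb, ff, Real.sq_sqrt (by positivity)]; push_cast; rfl
  have ha0 : 0 ≤ a := Real.sqrt_nonneg _
  have hb0 : 0 < b := Real.sqrt_pos.2 (by positivity)
  have hdiff : 1 / (2 * M) ≤ b^2 - a^2 := by
    rw [ha2, hb2, div_sub_div _ _ hMp.ne' hLp.ne', div_le_div_iff₀ (by positivity) (by positivity)]
    nlinarith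
  have hab : a ≤ b := by
    have : 0 < 1 / (2 * M) := by positivity
    nlinarith
  have hkey : 1 / (4 * (M * b)) ≤ b - a := by
    have : 1 / (2 * M) ≤ (b - a) * (2 * b) := by nlinarith
    calc 1 / (4 * (M * b)) = 1 / (2 * M) / (2 * b) := by field_simp; norm_num
      _ ≤ (b - a) * (2 * b) / (2 * b) := by gcongr
      _ = b - a := by field_simp
  have hw : wgt (n+1) ≤ 1 / (M * b) := by
    unfold wgt
    rw [max_eq_left (by omega), inv_eq_one_div]
    apply one_div_le_one_div_of_le (by positivity)
    unfold lilNorm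
    apply Real.le_sqrt_of_sq_le
    rw [mul_pow, hb2]
    change M^2 * ((n+1)/M) ≤ 2 * ((n+1:ℕ):ℝ) * M
    have : M^2 * (((n:ℝ)+1)/M) = (n+1) * M := by field_simp
    rw [this]; push_cast
    have : 0 < ((n:ℝ)+1)*M := by positivity
    linarith
  have : 1 / (M * b) = 4 * (1 / (4 * (M * b))) := by field_simp
  linarith

lemma wgt_sum : ∃ D : ℝ, 0 ≤ D ∧ ∀ n : ℕ,
    ∑ j ∈ Finset.range (n+1), wgt j ≤ 4 * ff n + D := by
  obtain ⟨n0, h0⟩ := eventually_atTop.1 ff_step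
  refine ⟨∑ j ∈ Finset.range (n0+1), wgt j, Finset.sum_nonneg fun j _ => (wgt_pos j).le, ?_⟩
  intro n
  have hf : ∀ n, 0 ≤ ff n := fun n => Real.sqrt_nonneg _
  rcases le_total n n0 with h | h
  · have : ∑ j ∈ Finset.range (n+1), wgt j ≤ ∑ j ∈ Finset.range (n0+1), wgt j :=
      Finset.sum_le_sum_of_subset_of_nonneg (Finset.range_mono (by omega))
        fun j _ _ => (wgt_pos j).le
    linarith [hf n]
  · induction n, h using Nat.le_induction with
    | base => linarith [hf n0]
    | succ n hn ih =>
      rw [Finset.sum_range_succ]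
      linarith [h0 n hn]

lemma wgt_trunc_sum (α : ℝ) (hα : 0 < α) : ∃ D : ℝ, 0 ≤ D ∧ ∀ (n : ℕ) (t : ℝ), 0 ≤ t →
    ∑ j ∈ Finset.range n, (if t ≤ α * ff j then 0 else wgt j) ≤ 4 / α * t + D := by
  obtain ⟨D, hD, h⟩ := wgt_sum
  refine ⟨D, hD, fun n t ht => ?_⟩
  induction n with
  | zero => simp; positivity
  | succ n ih =>
    by_cases hc : t ≤ α * ff n
    · rw [Finset.sum_range_succ, if_pos hc]; simpa using ih
    · push Not at hc
      calc _ ≤ ∑ j ∈ Finset.range (n+1), wgt j := by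
            apply Finset.sum_le_sum; intro j _
            split_ifs
            exacts [(wgt_pos j).le, le_rfl]
        _ ≤ 4 * ff n + D := h n
        _ ≤ _ := by
          have : 4 / α * (α * ff n) ≤ 4 / α * t := by gcongr
          have e : 4 / α * (α * ff n) = 4 * ff n := by field_simp
          linarith

lemma kronecker_lil (r : ℕ → ℝ) (h : Summable fun j => wgt j * |r j|) :
    Tendsto (fun n : ℕ => (∑ j ∈ Finset.range (n+1), r j) / lilNorm n) atTop (𝓝 0) := by
  have key := tendsto_tsum_of_dominated_convergence (𝓕 := atTop)
    (f := fun (n : ℕ) (j : ℕ) => if j < n + 1 then r j / lilNorm n else 0)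
    (g := fun _ => (0:ℝ)) h ?_ ?_
  · rw [tsum_zero] at key
    refine key.congr fun n => ?_
    rw [tsum_eq_sum (s := Finset.range (n+1))]
    · rw [Finset.sum_div]
      apply Finset.sum_congr rfl
      intro j hj
      rw [if_pos (Finset.mem_range.1 hj)]
    · intro j hj
      rw [if_neg (by simpa using hj)]
  · intro j
    have : Tendsto (fun n : ℕ => r j / lilNorm n) atTop (𝓝 0) :=
      tendsto_const_nhds.div_atTop tendsto_lilNorm
    refine this.congr' ?_
    filter_upwards [eventually_ge_atTop j] with n hn
    rw [if_pos (by omega)]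
  · filter_upwards [eventually_ge_atTop 3] with n hn j
    have hw := wgt_pos j
    split_ifs with hj
    · rw [norm_div, Real.norm_eq_abs, Real.norm_eq_abs, abs_of_pos (lilNorm_pos hn),
        div_eq_inv_mul]
      have : (lilNorm n)⁻¹ ≤ wgt j := by
        unfold wgt
        apply inv_anti₀ (lilNorm_pos (le_max_right _ _))
        exact lilNorm_mono (le_max_right _ _) (max_le (by omega) hn)
      gcongr
    · simp; positivity

/-- the tail function -/
def tl (c t : ℝ) : ℝ := if t ≤ c then 0 else t

lemma tl_meas (c : ℝ) : Measurable (tl c) :=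
  Measurable.ite measurableSet_Iic measurable_const measurable_id

lemma tl_nonneg (c : ℝ) {t : ℝ} (ht : 0 ≤ t) : 0 ≤ tl c t := by
  unfold tl; split_ifs <;> simp [ht]

lemma tl_le (c : ℝ) {t : ℝ} (ht : 0 ≤ t) : tl c t ≤ t := by
  unfold tl; split_ifs <;> simp [ht]

lemma tail_sum {G : Type*} [MeasurableSpace G] (N : G → ℝ) (hN0 : ∀ g, 0 ≤ N g)
    (μ : Measure G) (hmom1 : Integrable N μ)
    (hmom2 : Integrable (fun g => N g ^ 2) μ) (α : ℝ) (hα : 0 < α) :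
    (∀ c, Integrable (fun g => tl c (N g)) μ) ∧
    Summable fun j => wgt j * ∫ g, tl (α * ff j) (N g) ∂μ := by
  have hint : ∀ c, Integrable (fun g => tl c (N g)) μ := fun c =>
    hmom1.mono' ((tl_meas c).comp_aemeasurable hmom1.aemeasurable).aestronglyMeasurable
      (Eventually.of_forall fun g => by
        rw [Real.norm_eq_abs, abs_of_nonneg (tl_nonneg c (hN0 g))]; exact tl_le c (hN0 g))
  refine ⟨hint, ?_⟩
  obtain ⟨D, hD, h⟩ := wgt_trunc_sum α hα
  refine summable_of_sum_range_le (c := ∫ g, (4 / α * N g ^ 2 + D * N g) ∂μ)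
    (fun j => mul_nonneg (wgt_pos j).le (integral_nonneg fun g => tl_nonneg _ (hN0 g))) ?_
  intro n
  simp_rw [← integral_const_mul]
  rw [← integral_finset_sum _ fun j _ => (hint _).const_mul _]
  apply integral_mono (integrable_finset_sum _ fun j _ => (hint _).const_mul _)
    ((hmom2.const_mul _).add (hmom1.const_mul _))
  intro g
  have := mul_le_mul_of_nonneg_left (h n (N g) (hN0 g)) (hN0 g)
  rw [Finset.mul_sum] at this
  calc _ = ∑ j ∈ Finset.range n, N g * (if N g ≤ α * ff j then 0 else wgt j) := by
        apply Finset.sum_congr rfl; intro j _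
        unfold tl; split_ifs <;> ring
    _ ≤ _ := this
    _ = _ := by simp only [Pi.add_apply]; ring

lemma ae_summable_of {Ω : Type*} [MeasurableSpace Ω] (β : Measure Ω) (f : ℕ → Ω → ℝ)
    (hf0 : ∀ j b, 0 ≤ f j b) (hf : ∀ j, Integrable (f j) β)
    (hs : Summable fun j => ∫ b, f j b ∂β) : ∀ᵐ b ∂β, Summable fun j => f j b := by
  have h1 : ∫⁻ b, ∑' j, ENNReal.ofReal (f j b) ∂β ≠ ∞ := by
    rw [lintegral_tsum fun j => (hf j).aemeasurable.ennreal_ofReal]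
    have : ∀ j, ∫⁻ b, ENNReal.ofReal (f j b) ∂β = ENNReal.ofReal (∫ b, f j b ∂β) := fun j =>
      (ofReal_integral_eq_lintegral_ofReal (hf j) (Eventually.of_forall (hf0 j))).symm
    simp_rw [this]
    exact hs.tsum_ofReal_ne_top
  have h2 := ae_lt_top' (AEMeasurable.ennreal_tsum
    fun j => (hf j).aemeasurable.ennreal_ofReal) h1
  filter_upwards [h2] with b hb
  have := ENNReal.summable_toReal hb.ne
  refine this.congr fun j => ?_
  rw [ENNReal.toReal_ofReal (hf0 j b)]

lemma eval_mp {G : Type*} [MeasurableSpace G] (μ : Measure G) [IsProbabilityMeasure μ]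
    (β : Measure (ℕ → G))
    (hβ : ∀ n : ℕ, β.map (fun b (i : Fin n) => b i) = Measure.pi fun _ : Fin n => μ) (k : ℕ) :
    MeasurePreserving (fun b : ℕ → G => b k) β μ := by
  have h1 : MeasurePreserving (fun (b : ℕ → G) (i : Fin (k+1)) => b i) β
      (Measure.pi fun _ : Fin (k+1) => μ) :=
    ⟨measurable_pi_lambda _ fun i => measurable_pi_apply _, hβ _⟩
  have h2 := measurePreserving_eval (fun _ : Fin (k+1) => μ) (Fin.last k)
  exact h2.comp h1

/-- the truncated recentered sums approximate the cocycle up to o(a_n). -/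
theorem truncation_approximation
    {G : Type*} [Group G] [MeasurableSpace G] [MeasurableMul₂ G]
    {X : Type*} [MetricSpace X] [CompactSpace X] [MeasurableSpace X] [BorelSpace X]
    [MulAction G X] (hact : Measurable fun p : G × X => p.1 • p.2)
    (σ : G → X → ℝ)
    (hσmeas : Measurable fun p : G × X => σ p.1 p.2)
    (hcoc : ∀ g₁ g₂ : G, ∀ x : X, σ (g₂ * g₁) x = σ g₂ (g₁ • x) + σ g₁ x)
    (N : G → ℝ) (hN0 : ∀ g, 0 ≤ N g) (hNsub : ∀ g h : G, N (g * h) ≤ N g + N h)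
    (hNσ : ∀ g x, |σ g x| ≤ N g)
    (μ : Measure G) [IsProbabilityMeasure μ]
    (hmom1 : Integrable N μ)
    (hdrift : ∀ x, ∫ g, σ g x ∂μ = 0)
    (hmom2 : Integrable (fun g => N g ^ 2) μ)
    (β : Measure (ℕ → G)) [IsProbabilityMeasure β]
    (hβ : ∀ n : ℕ, β.map (fun b (i : Fin n) => b i) = Measure.pi fun _ : Fin n => μ)
    (x : X) (α : ℝ) (hα : 0 < α) :
    ∀ᵐ b ∂β,
      Tendsto (fun n : ℕ =>
          (σ (prodRev b n) x - truncSum σ N μ α x n b) / lilNorm n)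
        atTop (𝓝 0) := by
  obtain ⟨hint, hsum⟩ := tail_sum N hN0 μ hmom1 hmom2 α hα
  have hae : ∀ᵐ b ∂β, Summable fun j => wgt j * tl (α * ff j) (N (b (j - 1))) := by
    apply ae_summable_of β (fun j b => wgt j * tl (α * ff j) (N (b (j - 1))))
    · intro j b
      exact mul_nonneg (wgt_pos j).le (tl_nonneg _ (hN0 _))
    · intro j
      exact ((eval_mp μ β hβ (j-1)).integrable_comp_of_integrable (hint (α * ff j))).const_mul _
    · refine hsum.congr fun j => ?_
      rw [integral_const_mul]
      congr 1
      have e := eval_mp μ β hβ (j-1)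
      rw [← e.map_eq, integral_map e.measurable.aemeasurable]
      rw [e.map_eq]
      exact (hint (α * ff j)).1
  have hσ1 : ∀ y : X, Measurable fun g => σ g y := fun y =>
    hσmeas.comp (measurable_id.prodMk measurable_const)
  have hσint : ∀ y : X, Integrable (fun g => σ g y) μ := fun y =>
    hmom1.mono' (hσ1 y).aestronglyMeasurable (Eventually.of_forall fun g => hNσ g y)
  have htr : ∀ j g y, |σ g y - truncInc σ N α j g y| ≤ tl (α * ff j) (N g) := by
    intro j g y
    change |σ g y - (if N g ≤ α * ff j then σ g y else 0)| ≤ _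
    unfold tl
    split_ifs
    · simp
    · simpa using hNσ g y
  have htint : ∀ j y, Integrable (fun g => truncInc σ N α j g y) μ := by
    intro j y
    have hm : AEStronglyMeasurable (fun g => truncInc σ N α j g y) μ := by
      have h1 : Measurable fun t : ℝ => if t ≤ α * ff j then (1:ℝ) else 0 :=
        Measurable.ite measurableSet_Iic measurable_const measurable_const
      have h2 := (h1.comp_aemeasurable hmom1.aemeasurable).mul (hσ1 y).aemeasurable
      refine h2.aestronglyMeasurable.congr (Eventually.of_forall fun g => ?_)
      change (if N g ≤ α * ff j then (1:ℝ) else 0) * σ g y = if N g ≤ α * ff j then σ g y else 0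
      split_ifs <;> simp
    refine hmom1.mono' hm (Eventually.of_forall fun g => ?_)
    unfold truncInc
    split_ifs
    · exact hNσ g y
    · simpa using hN0 g
  have hmean : ∀ j y, |∫ g, truncInc σ N α j g y ∂μ| ≤ ∫ g, tl (α * ff j) (N g) ∂μ := by
    intro j y
    have e : ∫ g, (σ g y - truncInc σ N α j g y) ∂μ = - ∫ g, truncInc σ N α j g y ∂μ := by
      rw [integral_sub (hσint y) (htint j y), hdrift]; ring
    rw [← abs_neg, ← e]
    exact norm_integral_le_of_norm_le (f := fun g => σ g y - truncInc σ N α j g y)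
      (hint (α * ff j)) (Eventually.of_forall fun g => htr j g y)
  have hσone : ∀ y, σ 1 y = 0 := by
    intro y
    have := hcoc 1 1 y
    simp only [mul_one, one_smul] at this
    linarith
  filter_upwards [hae] with b hb
  let s : ℕ → ℝ := fun j => if j = 0 then 0 else σ (b (j-1)) (prodRev b (j-1) • x)
  let q : ℕ → ℝ := fun j =>
    if 3 ≤ j then truncIncC σ N μ α j (b (j - 1)) (prodRev b (j - 1) • x) else 0
  have hs : ∀ n, σ (prodRev b n) x = ∑ j ∈ Finset.range (n+1), s j := by
    intro n
    induction n with
    | zero => simp [s, prodRev, hσone]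
    | succ n ih =>
      rw [Finset.sum_range_succ, ← ih, prodRev, hcoc]
      simp [s, add_comm]
  have hq : ∀ n, truncSum σ N μ α x n b = ∑ j ∈ Finset.range (n+1), q j := by
    intro n
    unfold truncSum
    rw [← Finset.sum_filter]
    apply Finset.sum_congr _ fun _ _ => rfl
    ext j
    simp only [Finset.mem_Icc, Finset.mem_filter, Finset.mem_range]
    omega
  have hk := kronecker_lil (fun j => s j - q j) ?_
  · refine hk.congr fun n => ?_
    rw [hs, hq, Finset.sum_sub_distrib]
  · refine Summable.of_norm_bounded_eventually (hb.add hsum) ?_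
    rw [Nat.cofinite_eq_atTop]
    filter_upwards [eventually_ge_atTop 3] with j hj
    rw [Real.norm_eq_abs, abs_of_nonneg (mul_nonneg (wgt_pos j).le (abs_nonneg _)), ← mul_add]
    apply mul_le_mul_of_nonneg_left _ (wgt_pos j).le
    simp only [s, q, if_pos hj, if_neg (show j ≠ 0 by omega), truncIncC]
    have h1 := htr j (b (j-1)) (prodRev b (j-1) • x)
    have h2 := hmean j (prodRev b (j-1) • x)
    rw [← sub_add]
    exact (abs_add_le _ _).trans (add_le_add h1 h2)
end
end
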